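/- Let (R, m) be a complete Noetherian local ring, a an ideal, and M a finitely generated R-module. Then f^2_a(M) = inf{ i ∈ ℕ : H^i_a(M) is not weakly Laskerian }. -/

import Mathlib

open CategoryTheory

universe u

/-- An `R`-module `M` is *in dimension `< n`* if there is a finitely generated submodule `N`
of `M` such that the Krull dimension of `Supp (M/N)` is `< n`. -/
def InDimLT (R : Type u) [CommRing R] (M : Type u) [AddCommGroup M] [Module R M]
    (n : ℕ) : Prop :=
  ∃ N : Submodule R M, N.FG ∧
    Order.krullDim (Module.support R (M ⧸ N)) < (n : WithBot ℕ∞)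

/-- `f_a(M)`: the least `i` such that `H^i_a(M)` is not finitely generated (`⊤` if none). -/
noncomputable def fDim (R : Type u) [CommRing R] (a : Ideal R)
    (M : Type u) [AddCommGroup M] [Module R M] : ℕ∞ :=
  sInf {i : ℕ∞ | ∃ j : ℕ, i = j ∧
    ¬ Module.Finite R ((localCohomology a j).obj (ModuleCat.of R M))}

/-- `f^n_a(M) = inf { f_{aR_p}(M_p) : p ∈ Supp(M/aM), dim R/p ≥ n }`. -/
noncomputable def fDimN (R : Type u) [CommRing R] (a : Ideal R)
    (M : Type u) [AddCommGroup M] [Module R M] (n : ℕ) : ℕ∞ :=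
  sInf {i : ℕ∞ | ∃ p : PrimeSpectrum R,
    p ∈ Module.support R (M ⧸ (a • ⊤ : Submodule R M)) ∧
    (n : WithBot ℕ∞) ≤ ringKrullDim (R ⧸ p.asIdeal) ∧
    i = fDim (Localization.AtPrime p.asIdeal)
          (a.map (algebraMap R (Localization.AtPrime p.asIdeal)))
          (LocalizedModule p.asIdeal.primeCompl M)}

/-- `h^n_a(M)`: the least `i` such that `H^i_a(M)` is not in dimension `< n` (`⊤` if none). -/
noncomputable def hDim (R : Type u) [CommRing R] (a : Ideal R)
    (M : Type u) [AddCommGroup M] [Module R M] (n : ℕ) : ℕ∞ :=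
  sInf {i : ℕ∞ | ∃ j : ℕ, i = j ∧
    ¬ InDimLT R ((localCohomology a j).obj (ModuleCat.of R M)) n}

section LeftDerived

open CategoryTheory.Limits

universe v₁ v₂ u₁ u₂

namespace CategoryTheory

lemma comp_conj {D : Type*} [Category D] {A A' B B' E E' G G' : D}
    (a : A ≅ A') (b : B ≅ B') (e : E ≅ E') (g : G ≅ G')
    (x : A' ⟶ B') (d' : B' ⟶ G') (d : A' ⟶ E') (y : E' ⟶ G')
    (w : x ≫ d' = d ≫ y) :
    (a.hom ≫ x ≫ b.inv) ≫ b.hom ≫ d' ≫ g.inv =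
      (a.hom ≫ d ≫ e.inv) ≫ e.hom ≫ y ≫ g.inv := by
  simp [reassoc_of% w]

lemma exact_of_iso {D : Type*} [Category D] [Abelian D] {S : ShortComplex D} (hS : S.Exact)
    {A B E : D} (e₁ : S.X₁ ≅ A) (e₂ : S.X₂ ≅ B) (e₃ : S.X₃ ≅ E) (f : A ⟶ B) (g : B ⟶ E)
    (hf : e₁.hom ≫ f = S.f ≫ e₂.hom) (hg : e₂.hom ≫ g = S.g ≫ e₃.hom) :
    ∃ w : f ≫ g = 0, (ShortComplex.mk f g w).Exact := by
  have w : f ≫ g = 0 := by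
    rw [← cancel_epi e₁.hom, reassoc_of% hf, hg, S.zero_assoc, zero_comp, comp_zero]
  exact ⟨w, ShortComplex.exact_of_iso (S₂ := ShortComplex.mk f g w)
    (ShortComplex.isoMk e₁ e₂ e₃ hf hg) hS⟩

end CategoryTheory

variable {C : Type u₁} [Category.{v₁} C] [Abelian C]
  {D : Type u₂} [Category.{v₂} D] [Abelian D]
  {F₁ F₂ F₃ : C ⥤ D} [F₁.Additive] [F₂.Additive] [F₃.Additive]

namespace CategoryTheory.NatTrans

/-- A sequence of additive functors that is short exact on projective objects. -/
structure ShortExactOnProjectives (α : F₁ ⟶ F₂) (β : F₂ ⟶ F₃) : Prop where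
  zero : α ≫ β = 0
  shortExact (X : C) [Projective X] :
    (ShortComplex.mk (α.app X) (β.app X) (by rw [← NatTrans.comp_app, zero]; rfl)).ShortExact

lemma opcyclesMap_comp_fromLeftDerivedZero' (α : F₁ ⟶ F₂) {X : C}
    (P : ProjectiveResolution X) :
    HomologicalComplex.opcyclesMap ((NatTrans.mapHomologicalComplex α _).app P.complex) 0 ≫
      P.fromLeftDerivedZero' F₂ = P.fromLeftDerivedZero' F₁ ≫ α.app X := by
  rw [← cancel_epi (HomologicalComplex.pOpcycles _ _), HomologicalComplex.p_opcyclesMap_assoc,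
    ProjectiveResolution.pOpcycles_comp_fromLeftDerivedZero',
    ProjectiveResolution.pOpcycles_comp_fromLeftDerivedZero'_assoc]
  exact (α.naturality (P.π.f 0)).symm

namespace ShortExactOnProjectives

variable {α : F₁ ⟶ F₂} {β : F₂ ⟶ F₃}

/-- The short complex of chain complexes obtained by evaluating at a complex. -/
noncomputable def complexes (h : ShortExactOnProjectives α β)
    (K : ChainComplex C ℕ) : ShortComplex (ChainComplex D ℕ) where
  X₁ := (F₁.mapHomologicalComplex _).obj K
  X₂ := (F₂.mapHomologicalComplex _).obj K
  X₃ := (F₃.mapHomologicalComplex _).obj K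
  f := (NatTrans.mapHomologicalComplex α _).app K
  g := (NatTrans.mapHomologicalComplex β _).app K
  zero := by
    ext i
    exact congr_app h.zero (K.X i)

/-- Functoriality of `complexes`. -/
noncomputable def complexesMap (h : ShortExactOnProjectives α β)
    {K L : ChainComplex C ℕ} (φ : K ⟶ L) :
    h.complexes K ⟶ h.complexes L where
  τ₁ := (F₁.mapHomologicalComplex _).map φ
  τ₂ := (F₂.mapHomologicalComplex _).map φ
  τ₃ := (F₃.mapHomologicalComplex _).map φ
  comm₁₂ := NatTrans.mapHomologicalComplex_naturality α φ
  comm₂₃ := NatTrans.mapHomologicalComplex_naturality β φ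

lemma complexes_shortExact (h : ShortExactOnProjectives α β) {X : C} (P : ProjectiveResolution X) :
    (h.complexes P.complex).ShortExact :=
  HomologicalComplex.shortExact_of_degreewise_shortExact _ fun i => h.shortExact (P.complex.X i)

variable [EnoughProjectives C]

/-- The connecting natural transformation between left derived functors. -/
noncomputable def δ (h : ShortExactOnProjectives α β) (n : ℕ) :
    F₃.leftDerived (n + 1) ⟶ F₁.leftDerived n where
  app X := ((projectiveResolution X).isoLeftDerivedObj F₃ (n + 1)).hom ≫
    (h.complexes_shortExact (projectiveResolution X)).δ (n + 1) n (by simp) ≫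
    ((projectiveResolution X).isoLeftDerivedObj F₁ n).inv
  naturality X Y f := by
    have w := ProjectiveResolution.lift_commutes f (projectiveResolution X)
      (projectiveResolution Y)
    rw [Functor.leftDerived_map_eq F₃ (n + 1) f _ w, Functor.leftDerived_map_eq F₁ n f _ w]
    have := HomologicalComplex.HomologySequence.δ_naturality
      (h.complexesMap (ProjectiveResolution.lift f (projectiveResolution X)
      (projectiveResolution Y)))
      (h.complexes_shortExact (projectiveResolution X))
      (h.complexes_shortExact (projectiveResolution Y)) (n + 1) n (by simp)
    exact comp_conj _ _ _ _ _ _ _ _ this.symm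

/-- Exactness of the long exact sequence at `F₂`. -/
lemma exact₂ (h : ShortExactOnProjectives α β) (n : ℕ) (X : C) :
    ∃ w, (ShortComplex.mk ((NatTrans.leftDerived α n).app X)
      ((NatTrans.leftDerived β n).app X) w).Exact := by
  refine exact_of_iso ((h.complexes_shortExact (projectiveResolution X)).homology_exact₂ n)
    ((projectiveResolution X).isoLeftDerivedObj F₁ n).symm
    ((projectiveResolution X).isoLeftDerivedObj F₂ n).symm
    ((projectiveResolution X).isoLeftDerivedObj F₃ n).symm _ _ ?_ ?_
  · simp only [ProjectiveResolution.leftDerived_app_eq α (projectiveResolution X), Iso.symm_hom]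
    exact Iso.inv_hom_id_assoc _ _
  · simp only [ProjectiveResolution.leftDerived_app_eq β (projectiveResolution X), Iso.symm_hom]
    exact Iso.inv_hom_id_assoc _ _

/-- Exactness of the long exact sequence at `F₃`. -/
lemma exact₃ (h : ShortExactOnProjectives α β) (n : ℕ) (X : C) :
    ∃ w, (ShortComplex.mk ((NatTrans.leftDerived β (n + 1)).app X)
      ((h.δ n).app X) w).Exact := by
  refine exact_of_iso ((h.complexes_shortExact (projectiveResolution X)).homology_exact₃
      (n + 1) n (by simp))
    ((projectiveResolution X).isoLeftDerivedObj F₂ (n + 1)).symm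
    ((projectiveResolution X).isoLeftDerivedObj F₃ (n + 1)).symm
    ((projectiveResolution X).isoLeftDerivedObj F₁ n).symm _ _ ?_ ?_
  · simp only [ProjectiveResolution.leftDerived_app_eq β (projectiveResolution X), Iso.symm_hom]
    exact Iso.inv_hom_id_assoc _ _
  · simp only [δ, Iso.symm_hom]
    exact Iso.inv_hom_id_assoc _ _

/-- Exactness of the long exact sequence at `F₁`. -/
lemma exact₁ (h : ShortExactOnProjectives α β) (n : ℕ) (X : C) :
    ∃ w, (ShortComplex.mk ((h.δ n).app X) ((NatTrans.leftDerived α n).app X) w).Exact := by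
  refine exact_of_iso ((h.complexes_shortExact (projectiveResolution X)).homology_exact₁
      (n + 1) n (by simp))
    ((projectiveResolution X).isoLeftDerivedObj F₃ (n + 1)).symm
    ((projectiveResolution X).isoLeftDerivedObj F₁ n).symm
    ((projectiveResolution X).isoLeftDerivedObj F₂ n).symm _ _ ?_ ?_
  · simp only [δ, Iso.symm_hom]
    exact Iso.inv_hom_id_assoc _ _
  · simp only [ProjectiveResolution.leftDerived_app_eq α (projectiveResolution X), Iso.symm_hom]
    exact Iso.inv_hom_id_assoc _ _

end ShortExactOnProjectives

/-- The comparison from the zeroth left derived functor is natural in the functor. -/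
lemma leftDerived_zero_comp_fromLeftDerivedZero [EnoughProjectives C] (α : F₁ ⟶ F₂) :
    NatTrans.leftDerived α 0 ≫ F₂.fromLeftDerivedZero = F₁.fromLeftDerivedZero ≫ α := by
  ext X
  dsimp
  have h := HomologicalComplex.homologyι_naturality
    ((NatTrans.mapHomologicalComplex α _).app (projectiveResolution X).complex) 0
  rw [(projectiveResolution X).fromLeftDerivedZero_eq,
    (projectiveResolution X).fromLeftDerivedZero_eq,
    ProjectiveResolution.leftDerived_app_eq α (projectiveResolution X),
    Category.assoc, Category.assoc, Category.assoc]
  congr 1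
  refine (congrArg _ (Iso.inv_hom_id_assoc _ _)).trans (((reassoc_of% h) _).trans ?_)
  exact (congrArg _ (opcyclesMap_comp_fromLeftDerivedZero' α _)).trans
    (Category.assoc _ _ _).symm

end CategoryTheory.NatTrans
end LeftDerived

section ExtSequence

variable {R : Type u} [CommRing R]

namespace ModuleCat

open Limits Opposite

lemma linearYoneda_shortExactOnProjectives {S : ShortComplex (ModuleCat.{u} R)}
    (hS : S.ShortExact) :
    NatTrans.ShortExactOnProjectives
      (NatTrans.rightOp ((linearYoneda R (ModuleCat.{u} R)).map S.g))
      (NatTrans.rightOp ((linearYoneda R (ModuleCat.{u} R)).map S.f)) where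
  zero := by
    ext X
    apply Quiver.Hom.unop_inj
    ext (φ : X ⟶ S.X₁) : 2
    change (φ ≫ S.f) ≫ S.g = 0
    rw [Category.assoc, S.zero, comp_zero]
  shortExact P _ := by
    have := hS.mono_f
    have := hS.epi_g
    let T : ShortComplex (ModuleCat.{u} R) :=
      ShortComplex.mk (((linearYoneda R (ModuleCat.{u} R)).map S.f).app (op P))
        (((linearYoneda R (ModuleCat.{u} R)).map S.g).app (op P)) (by
          ext (φ : P ⟶ S.X₁) : 2
          change (φ ≫ S.f) ≫ S.g = 0
          rw [Category.assoc, S.zero, comp_zero])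
    have hT : T.ShortExact :=
      { exact := by
          rw [ShortComplex.moduleCat_exact_iff]
          intro (x : P ⟶ S.X₂) (hx : x ≫ S.g = 0)
          exact ⟨hS.exact.lift x hx, hS.exact.lift_f x hx⟩
        mono_f := by
          rw [ModuleCat.mono_iff_injective]
          intro (x : P ⟶ S.X₁) (y : P ⟶ S.X₁) (hxy : x ≫ S.f = y ≫ S.f)
          exact (cancel_mono _).1 hxy
        epi_g := by
          rw [ModuleCat.epi_iff_surjective]
          intro (x : P ⟶ S.X₃)
          exact ⟨Projective.factorThru x S.g, Projective.factorThru_comp x S.g⟩ }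
    exact hT.op

/-- The connecting homomorphism of `Ext` in the second variable, natural in the first one. -/
noncomputable def extδ {S : ShortComplex (ModuleCat.{u} R)} (hS : S.ShortExact) (i : ℕ) :
    (Ext R (ModuleCat.{u} R) i).flip.obj S.X₃ ⟶ (Ext R (ModuleCat.{u} R) (i + 1)).flip.obj S.X₁ :=
  NatTrans.leftOp ((linearYoneda_shortExactOnProjectives hS).δ i)

section

variable {S : ShortComplex (ModuleCat.{u} R)} (hS : S.ShortExact) (i : ℕ)
  (X : (ModuleCat.{u} R)ᵒᵖ)

lemma ext_exact₂ {S : ShortComplex (ModuleCat.{u} R)} (hS : S.ShortExact) (i : ℕ)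
    (X : (ModuleCat.{u} R)ᵒᵖ) : Function.Exact (((Ext R (ModuleCat.{u} R) i).obj X).map S.f).hom
    (((Ext R (ModuleCat.{u} R) i).obj X).map S.g).hom := by
  obtain ⟨w, h⟩ := (linearYoneda_shortExactOnProjectives hS).exact₂ i X.unop
  exact (ShortComplex.ShortExact.moduleCat_exact_iff_function_exact _).1 h.unop

lemma ext_exact₃ : Function.Exact (((Ext R (ModuleCat.{u} R) i).obj X).map S.g).hom
    ((extδ hS i).app X).hom := by
  obtain ⟨w, h⟩ := (linearYoneda_shortExactOnProjectives hS).exact₁ i X.unop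
  exact (ShortComplex.ShortExact.moduleCat_exact_iff_function_exact _).1 h.unop

lemma ext_exact₁ : Function.Exact ((extδ hS i).app X).hom
    (((Ext R (ModuleCat.{u} R) (i + 1)).obj X).map S.f).hom := by
  obtain ⟨w, h⟩ := (linearYoneda_shortExactOnProjectives hS).exact₃ i X.unop
  exact (ShortComplex.ShortExact.moduleCat_exact_iff_function_exact _).1 h.unop

end

lemma isZero_ext_succ_of_injective (X I : ModuleCat.{u} R) [Injective I] (n : ℕ) :
    IsZero (((Ext R (ModuleCat.{u} R) (n + 1)).obj (op X)).obj I) := by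
  refine IsZero.of_iso ?_ ((CategoryTheory.projectiveResolution X).isoExt (n + 1) I)
  rw [← HomologicalComplex.exactAt_iff_isZero_homology,
    HomologicalComplex.exactAt_iff' _ n (n + 1) (n + 2) (by simp) (by simp),
    ShortComplex.moduleCat_exact_iff]
  intro (x : (CategoryTheory.projectiveResolution X).complex.X (n + 1) ⟶ I)
    (hx : (CategoryTheory.projectiveResolution X).complex.d (n + 2) (n + 1) ≫ x = 0)
  have h := (CategoryTheory.projectiveResolution X).complex_exactAt_succ n
  rw [HomologicalComplex.exactAt_iff' _ (n + 2) (n + 1) n (by simp) (by simp)] at h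
  exact ⟨h.descToInjective x hx, h.comp_descToInjective x hx⟩

instance linearYoneda_preservesFiniteLimits (Y : ModuleCat.{u} R) :
    PreservesFiniteLimits ((linearYoneda R (ModuleCat.{u} R)).obj Y) :=
  have : PreservesLimits ((linearYoneda R (ModuleCat.{u} R)).obj Y ⋙ forget _) :=
    (inferInstance : PreservesLimits (yoneda.obj Y))
  have : PreservesLimits ((linearYoneda R (ModuleCat.{u} R)).obj Y) :=
    preservesLimits_of_reflects_of_preserves _ (forget _)
  PreservesLimits.preservesFiniteLimits _

instance linearYoneda_rightOp_preservesFiniteColimits (Y : ModuleCat.{u} R) :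
    PreservesFiniteColimits ((linearYoneda R (ModuleCat.{u} R)).obj Y).rightOp :=
  preservesFiniteColimits_rightOp _

end ModuleCat
end ExtSequence

section LocalCohomologySequence

open Limits Opposite

variable {R : Type u} [CommRing R]

namespace ModuleCat

instance preservesColimitsOfShape_forget (J : Type) [SmallCategory J] [IsFiltered J] :
    PreservesColimitsOfShape J (forget (ModuleCat.{u} R)) :=
  have := preservesSmallestFilteredColimits_of_preservesFilteredColimits
    (forget (ModuleCat.{u} R))
  PreservesFilteredColimitsOfSize.preserves_filtered_colimits J

lemma exact_of_isColimit {J : Type} [SmallCategory J] [IsFiltered J]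
    {F G H : J ⥤ ModuleCat.{u} R} (α : F ⟶ G) (β : G ⟶ H) {cF : Cocone F} {cG : Cocone G}
    {cH : Cocone H} (hF : IsColimit cF) (hG : IsColimit cG) (hH : IsColimit cH)
    (f : cF.pt ⟶ cG.pt) (g : cG.pt ⟶ cH.pt) (hf : ∀ j, cF.ι.app j ≫ f = α.app j ≫ cG.ι.app j)
    (hg : ∀ j, cG.ι.app j ≫ g = β.app j ≫ cH.ι.app j)
    (h : ∀ j, Function.Exact (α.app j).hom (β.app j).hom) : Function.Exact f.hom g.hom := by
  intro x
  have hf' (j : J) (y : F.obj j) :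
      f.hom ((cF.ι.app j).hom y) = (cG.ι.app j).hom ((α.app j).hom y) :=
    congr($(hf j).hom y)
  have hg' (j : J) (y : G.obj j) :
      g.hom ((cG.ι.app j).hom y) = (cH.ι.app j).hom ((β.app j).hom y) :=
    congr($(hg j).hom y)
  constructor
  · intro hx
    obtain ⟨j, y, rfl⟩ := Concrete.isColimit_exists_rep G hG x
    have hx' : (cH.ι.app j).hom ((β.app j).hom y) = (cH.ι.app j).hom 0 := by
      rw [← hg', map_zero]; exact hx
    obtain ⟨k, s, t, hst⟩ := Concrete.isColimit_exists_of_rep_eq H hH _ _ hx'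
    have h0 : (β.app k).hom ((G.map s).hom y) = 0 := by
      have := congr($(β.naturality s).hom y)
      refine this.trans (hst.trans ?_)
      exact map_zero _
    obtain ⟨z, hz⟩ := (h k _).1 h0
    refine ⟨(cF.ι.app k).hom z, ?_⟩
    rw [hf', hz]
    exact congr($(cG.w s).hom y)
  · rintro ⟨z, rfl⟩
    obtain ⟨j, y, rfl⟩ := Concrete.isColimit_exists_rep F hF z
    have h0 : (β.app j).hom ((α.app j).hom y) = 0 := (h j _).2 ⟨y, rfl⟩
    refine (congrArg g.hom (hf' j y)).trans ?_
    rw [hg', h0, map_zero]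

end ModuleCat

namespace localCohomology

variable (a : Ideal R)

/-- The cocone exhibiting a local cohomology module as a filtered colimit of `Ext` modules. -/
noncomputable def cocone (i : ℕ) (X : ModuleCat.{u} R) :
    Cocone ((ringModIdeals (idealPowersDiagram a)).op ⋙ (Ext R (ModuleCat.{u} R) i).flip.obj X) :=
  ((evaluation _ _).obj X).mapCocone (colimit.cocone (diagram (idealPowersDiagram a) i))

/-- Local cohomology modules are filtered colimits of `Ext` modules. -/
noncomputable def isColimitCocone (i : ℕ) (X : ModuleCat.{u} R) : IsColimit (cocone a i X) :=
  isColimitOfPreserves ((evaluation _ _).obj X)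
    (colimit.isColimit (diagram (idealPowersDiagram a) i))

lemma cocone_ι_naturality (i : ℕ) {X Y : ModuleCat.{u} R} (f : X ⟶ Y) (d : ℕᵒᵖᵒᵖ) :
    (cocone a i X).ι.app d ≫ (localCohomology a i).map f =
      ((Ext R (ModuleCat.{u} R) i).flip.map f).app _ ≫ (cocone a i Y).ι.app d :=
  ((colimit.ι (diagram (idealPowersDiagram a) i) d).naturality f).symm

section

variable {S : ShortComplex (ModuleCat.{u} R)} (hS : S.ShortExact) (i : ℕ)

/-- The connecting homomorphism for local cohomology. -/
noncomputable def δ : (localCohomology a i).obj S.X₃ ⟶ (localCohomology a (i + 1)).obj S.X₁ :=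
  (isColimitCocone a i S.X₃).map (cocone a (i + 1) S.X₁)
    (Functor.whiskerLeft (ringModIdeals (idealPowersDiagram a)).op (ModuleCat.extδ hS i))

lemma cocone_ι_δ (d : ℕᵒᵖᵒᵖ) : (cocone a i S.X₃).ι.app d ≫ δ a hS i =
    (ModuleCat.extδ hS i).app _ ≫ (cocone a (i + 1) S.X₁).ι.app d :=
  (isColimitCocone a i S.X₃).ι_map _ _ _

lemma exact₂ {S : ShortComplex (ModuleCat.{u} R)} (hS : S.ShortExact) (i : ℕ) :
    Function.Exact ((localCohomology a i).map S.f).hom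
    ((localCohomology a i).map S.g).hom :=
  ModuleCat.exact_of_isColimit
    (Functor.whiskerLeft (ringModIdeals (idealPowersDiagram a)).op ((Ext R _ i).flip.map S.f))
    (Functor.whiskerLeft (ringModIdeals (idealPowersDiagram a)).op ((Ext R _ i).flip.map S.g))
    (isColimitCocone a i _) (isColimitCocone a i _) (isColimitCocone a i _) _ _
    (cocone_ι_naturality a i S.f) (cocone_ι_naturality a i S.g)
    (fun d ↦ ModuleCat.ext_exact₂ hS i ((ringModIdeals (idealPowersDiagram a)).op.obj d))

lemma exact₃ : Function.Exact ((localCohomology a i).map S.g).hom (δ a hS i).hom :=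
  ModuleCat.exact_of_isColimit
    (Functor.whiskerLeft (ringModIdeals (idealPowersDiagram a)).op ((Ext R _ i).flip.map S.g))
    (Functor.whiskerLeft (ringModIdeals (idealPowersDiagram a)).op (ModuleCat.extδ hS i))
    (isColimitCocone a i _) (isColimitCocone a i _) (isColimitCocone a (i + 1) _) _ _
    (cocone_ι_naturality a i S.g) (cocone_ι_δ a hS i)
    (fun d ↦ ModuleCat.ext_exact₃ hS i ((ringModIdeals (idealPowersDiagram a)).op.obj d))

lemma exact₁ : Function.Exact (δ a hS i).hom ((localCohomology a (i + 1)).map S.f).hom :=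
  ModuleCat.exact_of_isColimit
    (Functor.whiskerLeft (ringModIdeals (idealPowersDiagram a)).op (ModuleCat.extδ hS i))
    (Functor.whiskerLeft (ringModIdeals (idealPowersDiagram a)).op ((Ext R _ (i + 1)).flip.map S.f))
    (isColimitCocone a i _) (isColimitCocone a (i + 1) _) (isColimitCocone a (i + 1) _) _ _
    (cocone_ι_δ a hS i) (cocone_ι_naturality a (i + 1) S.f)
    (fun d ↦ ModuleCat.ext_exact₁ hS i ((ringModIdeals (idealPowersDiagram a)).op.obj d))

end

lemma subsingleton_succ_of_injective (I : ModuleCat.{u} R) [Injective I] (i : ℕ) :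
    Subsingleton ((localCohomology a (i + 1)).obj I) := by
  have h (x : (localCohomology a (i + 1)).obj I) : x = 0 := by
    obtain ⟨d, y, rfl⟩ := Concrete.isColimit_exists_rep _ (isColimitCocone a (i + 1) I) x
    have := (ModuleCat.isZero_iff_subsingleton).1
      (ModuleCat.isZero_ext_succ_of_injective (R := R)
      (((ringModIdeals (idealPowersDiagram a)).op.obj d).unop) I i)
    have hy : y = 0 := this.elim y 0
    rw [hy]
    exact map_zero ((cocone a (i + 1) I).ι.app d).hom
  exact ⟨fun x y ↦ (h x).trans (h y).symm⟩

section Zero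

variable (X : ModuleCat.{u} R)

/-- `Ext⁰` is `Hom`. -/
noncomputable def extZeroIso : (linearYoneda R (ModuleCat.{u} R)).obj X ≅
    (Ext R (ModuleCat.{u} R) 0).flip.obj X where
  hom :=
    NatTrans.leftOp ((linearYoneda R (ModuleCat.{u} R)).obj X).rightOp.leftDerivedZeroIsoSelf.hom
  inv :=
    NatTrans.leftOp ((linearYoneda R (ModuleCat.{u} R)).obj X).rightOp.leftDerivedZeroIsoSelf.inv
  hom_inv_id := by
    exact congrArg NatTrans.leftOp (Iso.inv_hom_id
      ((linearYoneda R (ModuleCat.{u} R)).obj X).rightOp.leftDerivedZeroIsoSelf)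
  inv_hom_id := by
    exact congrArg NatTrans.leftOp (Iso.hom_inv_id
      ((linearYoneda R (ModuleCat.{u} R)).obj X).rightOp.leftDerivedZeroIsoSelf)

lemma extZeroIso_hom_naturality {X Y : ModuleCat.{u} R} (f : X ⟶ Y) :
    (linearYoneda R (ModuleCat.{u} R)).map f ≫ (extZeroIso Y).hom =
      (extZeroIso X).hom ≫ (Ext R (ModuleCat.{u} R) 0).flip.map f := by
  have := NatTrans.leftDerived_zero_comp_fromLeftDerivedZero
    (NatTrans.rightOp ((linearYoneda R (ModuleCat.{u} R)).map f))
  exact congrArg NatTrans.leftOp this.symm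

/-- Evaluation at `1`. -/
noncomputable def evalOneCocone : Cocone ((ringModIdeals (idealPowersDiagram a)).op ⋙
    (linearYoneda R (ModuleCat.{u} R)).obj X) where
  pt := X
  ι :=
    { app d := ModuleCat.ofHom
        { toFun (φ : (ringModIdeals (idealPowersDiagram a)).obj d.unop ⟶ X) :=
            φ.hom (Ideal.Quotient.mk (a ^ d.unop.unop) 1)
          map_add' _ _ := rfl
          map_smul' _ _ := rfl }
      naturality d e s := by
        ext φ
        rfl }

/-- The natural map from the zeroth local cohomology. -/
noncomputable def ιZero : (localCohomology a 0).obj X ⟶ X :=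
  (isColimitCocone a 0 X).map (evalOneCocone a X)
    (Functor.whiskerLeft (ringModIdeals (idealPowersDiagram a)).op (extZeroIso X).inv)

lemma cocone_ι_ιZero (d : ℕᵒᵖᵒᵖ) : (cocone a 0 X).ι.app d ≫ ιZero a X =
    (extZeroIso X).inv.app _ ≫ (evalOneCocone a X).ι.app d :=
  (isColimitCocone a 0 X).ι_map _ _ _

lemma exists_rep_zero (x : (localCohomology a 0).obj X) : ∃ (n : ℕ)
    (φ : (R ⧸ a ^ n) →ₗ[R] X), x = ((cocone a 0 X).ι.app (op (op n))).hom
        (((extZeroIso X).hom.app (op (ModuleCat.of R (R ⧸ a ^ n)))).hom (ModuleCat.ofHom φ)) ∧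
      (ιZero a X).hom x = φ (Ideal.Quotient.mk _ 1) := by
  obtain ⟨d, y, rfl⟩ := Concrete.isColimit_exists_rep _ (isColimitCocone a 0 X) x
  let φ : ModuleCat.of R (R ⧸ a ^ d.unop.unop) ⟶ X := ((extZeroIso X).inv.app
    (op (ModuleCat.of R (R ⧸ a ^ d.unop.unop)))).hom y
  refine ⟨d.unop.unop, φ.hom, ?_, ?_⟩
  · refine congrArg ((cocone a 0 X).ι.app d).hom ?_
    exact congr($((extZeroIso X).inv_hom_id_app _).hom y).symm
  · exact congr($(cocone_ι_ιZero a X d).hom y)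

lemma ιZero_injective : Function.Injective (ιZero a X).hom := by
  rw [injective_iff_map_eq_zero]
  intro x hx
  obtain ⟨n, φ, rfl, h⟩ := exists_rep_zero a X x
  have : φ = 0 := by
    refine Submodule.linearMap_qext _ (LinearMap.ext_ring ?_)
    exact h.symm.trans hx
  subst this
  rw [ModuleCat.ofHom_zero]
  exact (congrArg _ (map_zero _)).trans (map_zero _)

lemma ιZero_app (n : ℕ) (φ : (R ⧸ a ^ n) →ₗ[R] X) :
    (ιZero a X).hom (((cocone a 0 X).ι.app (op (op n))).hom
        (((extZeroIso X).hom.app (op (ModuleCat.of R (R ⧸ a ^ n)))).hom (ModuleCat.ofHom φ))) =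
      φ (Ideal.Quotient.mk _ 1) := by
  refine (congr($(cocone_ι_ιZero a X (op (op n))).hom _)).trans ?_
  exact congrArg ((evalOneCocone a X).ι.app (op (op n))).hom
    congr($((extZeroIso X).hom_inv_id_app _).hom (ModuleCat.ofHom φ))

lemma mem_range_ιZero (x : X) :
    x ∈ LinearMap.range (ιZero a X).hom ↔ ∃ n : ℕ, ∀ r ∈ a ^ n, r • x = 0 := by
  constructor
  · rintro ⟨y, rfl⟩
    obtain ⟨n, φ, -, h⟩ := exists_rep_zero a X y
    refine ⟨n, fun r hr ↦ ?_⟩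
    rw [h, ← map_smul]
    have : r • (Ideal.Quotient.mk (a ^ n) 1) = 0 := by
      rw [← Ideal.Quotient.mk_eq_mk, ← Submodule.Quotient.mk_smul]
      simpa [Ideal.Quotient.eq_zero_iff_mem] using hr
    rw [this, map_zero]
  · rintro ⟨n, hn⟩
    let φ : (R ⧸ a ^ n) →ₗ[R] X := Submodule.liftQ (a ^ n) (LinearMap.toSpanSingleton R X x)
      (fun r hr ↦ hn r hr)
    refine ⟨_, (ιZero_app a X n φ).trans ?_⟩
    exact (Submodule.liftQ_apply _ _ _).trans (one_smul R x)

lemma ιZero_naturality {X Y : ModuleCat.{u} R} (f : X ⟶ Y) :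
    (localCohomology a 0).map f ≫ ιZero a Y = ιZero a X ≫ f := by
  ext x
  obtain ⟨n, φ, rfl, h⟩ := exists_rep_zero a X x
  change (ιZero a Y).hom (((localCohomology a 0).map f).hom _) = f.hom ((ιZero a X).hom _)
  rw [h]
  have h₁ := congr($(cocone_ι_naturality a 0 f (op (op n))).hom
    (((extZeroIso X).hom.app (op (ModuleCat.of R (R ⧸ a ^ n)))).hom (ModuleCat.ofHom φ)))
  refine (congrArg (ιZero a Y).hom h₁).trans ?_
  have h₂ := congr(($(extZeroIso_hom_naturality f).app
    (op (ModuleCat.of R (R ⧸ a ^ n)))).hom (ModuleCat.ofHom φ))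
  refine (congrArg (fun z ↦ (ιZero a Y).hom (((cocone a 0 Y).ι.app (op (op n))).hom z))
    h₂.symm).trans ?_
  exact ιZero_app a Y n (f.hom ∘ₗ φ)

end Zero

end localCohomology
end LocalCohomologySequence

section LocCoh

variable {R : Type u} [CommRing R] (a : Ideal R)

/-- Local cohomology of an unbundled module. -/
abbrev LocCoh (i : ℕ) (X : Type u) [AddCommGroup X] [Module R X] : Type u :=
  (localCohomology a i).obj (ModuleCat.of R X)

namespace LocCoh

variable {X Y Z : Type u} [AddCommGroup X] [Module R X] [AddCommGroup Y] [Module R Y]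
  [AddCommGroup Z] [Module R Z]

/-- Functoriality of local cohomology. -/
noncomputable def map (i : ℕ) (f : X →ₗ[R] Y) : LocCoh a i X →ₗ[R] LocCoh a i Y :=
  ((localCohomology a i).map (ModuleCat.ofHom f)).hom

lemma exists_connecting {f : X →ₗ[R] Y} {g : Y →ₗ[R] Z} (hf : Function.Injective f)
    (hfg : Function.Exact f g) (hg : Function.Surjective g) (i : ℕ) :
    Function.Exact (map a i f) (map a i g) ∧ ∃ δ : LocCoh a i Z →ₗ[R] LocCoh a (i + 1) X,
      Function.Exact (map a i g) δ ∧ Function.Exact δ (map a (i + 1) f) := by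
  let S : ShortComplex (ModuleCat.{u} R) := ShortComplex.mk (ModuleCat.ofHom f) (ModuleCat.ofHom g)
    (by ext x; exact hfg.apply_apply_eq_zero x)
  have hS : S.ShortExact :=
    { exact := (ShortComplex.ShortExact.moduleCat_exact_iff_function_exact _).2 hfg
      mono_f := (ModuleCat.mono_iff_injective _).2 hf
      epi_g := (ModuleCat.epi_iff_surjective _).2 hg }
  exact ⟨localCohomology.exact₂ a hS i, (localCohomology.δ a hS i).hom,
    localCohomology.exact₃ a hS i, localCohomology.exact₁ a hS i⟩

lemma exists_linearEquiv_succ {f : X →ₗ[R] Y} {g : Y →ₗ[R] Z} (hf : Function.Injective f)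
    (hfg : Function.Exact f g) (hg : Function.Surjective g) (i : ℕ)
    [Subsingleton (LocCoh a i Y)] [Subsingleton (LocCoh a (i + 1) Y)] :
    Nonempty (LocCoh a i Z ≃ₗ[R] LocCoh a (i + 1) X) := by
  obtain ⟨-, δ, h₁, h₂⟩ := exists_connecting a hf hfg hg i
  refine ⟨LinearEquiv.ofBijective δ ⟨?_, fun x ↦ (h₂ x).1 (Subsingleton.elim _ _)⟩⟩
  rw [injective_iff_map_eq_zero]
  intro x hx
  obtain ⟨y, rfl⟩ := (h₁ x).1 hx
  rw [Subsingleton.elim y 0, map_zero]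

instance subsingleton_succ_of_injective [Module.Injective R X] (i : ℕ) :
    Subsingleton (LocCoh a (i + 1) X) :=
  have := Module.injective_object_of_injective_module R X
  localCohomology.subsingleton_succ_of_injective a (ModuleCat.of R X) i

variable (X) in
/-- The natural map from the zeroth local cohomology. -/
noncomputable def ι : LocCoh a 0 X →ₗ[R] X := (localCohomology.ιZero a (ModuleCat.of R X)).hom

lemma ι_injective : Function.Injective (ι a X) := localCohomology.ιZero_injective a _

lemma mem_range_ι (x : X) : x ∈ LinearMap.range (ι a X) ↔ ∃ n : ℕ, ∀ r ∈ a ^ n, r • x = 0 :=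
  localCohomology.mem_range_ιZero a (ModuleCat.of R X) x

lemma ι_map (f : X →ₗ[R] Y) (x : LocCoh a 0 X) : ι a Y (map a 0 f x) = f (ι a X x) :=
  congr($(localCohomology.ιZero_naturality a (ModuleCat.ofHom f)).hom x)

end LocCoh

variable (X : Type u) [AddCommGroup X] [Module R X]

/-- The submodule of elements killed by a power of the ideal. -/
def powTorsion : Submodule R X where
  carrier := {x | ∃ n : ℕ, ∀ r ∈ a ^ n, r • x = 0}
  add_mem' := by
    rintro x y ⟨m, hm⟩ ⟨n, hn⟩
    refine ⟨m + n, fun r hr ↦ ?_⟩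
    rw [smul_add, hm r (Ideal.pow_le_pow_right (Nat.le_add_right _ _) hr),
      hn r (Ideal.pow_le_pow_right (Nat.le_add_left _ _) hr), add_zero]
  zero_mem' := ⟨0, fun r _ ↦ smul_zero r⟩
  smul_mem' := by
    rintro c x ⟨n, hn⟩
    exact ⟨n, fun r hr ↦ by rw [smul_comm, hn r hr, smul_zero]⟩

variable {X}

lemma mem_powTorsion {x : X} : x ∈ powTorsion a X ↔ ∃ n : ℕ, ∀ r ∈ a ^ n, r • x = 0 := Iff.rfl

lemma range_ι_eq_powTorsion : LinearMap.range (LocCoh.ι a X) = powTorsion a X :=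
  Submodule.ext fun x ↦ LocCoh.mem_range_ι a x

/-- The zeroth local cohomology is the torsion submodule. -/
noncomputable def LocCoh.zeroEquiv : LocCoh a 0 X ≃ₗ[R] powTorsion a X :=
  (LinearEquiv.ofInjective _ (LocCoh.ι_injective a)).trans
    (LinearEquiv.ofEq _ _ (range_ι_eq_powTorsion a))

lemma exists_pow_smul_eq_zero_of_fg {N : Submodule R X} (hN : N.FG)
    (h : N ≤ powTorsion a X) : ∃ n : ℕ, ∀ r ∈ a ^ n, ∀ x ∈ N, r • x = 0 := by
  induction N, hN using Submodule.fg_induction with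
  | singleton x =>
    obtain ⟨n, hn⟩ := h (Submodule.mem_span_singleton_self x)
    refine ⟨n, fun r hr y hy ↦ ?_⟩
    obtain ⟨c, rfl⟩ := Submodule.mem_span_singleton.1 hy
    rw [smul_comm, hn r hr, smul_zero]
  | sup N₁ N₂ _ _ h₁ h₂ =>
    obtain ⟨n₁, h₁⟩ := h₁ (le_sup_left.trans h)
    obtain ⟨n₂, h₂⟩ := h₂ (le_sup_right.trans h)
    refine ⟨n₁ + n₂, fun r hr x hx ↦ ?_⟩
    obtain ⟨y, hy, z, hz, rfl⟩ := Submodule.mem_sup.1 hx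
    rw [smul_add, h₁ r (Ideal.pow_le_pow_right (Nat.le_add_right _ _) hr) y hy,
      h₂ r (Ideal.pow_le_pow_right (Nat.le_add_left _ _) hr) z hz, add_zero]

/-- An element is torsion as soon as its multiples by a power of the ideal are. -/
lemma mem_powTorsion_of_pow_smul_mem (ha : a.FG) {x : X} (n : ℕ)
    (h : ∀ r ∈ a ^ n, r • x ∈ powTorsion a X) : x ∈ powTorsion a X := by
  have hfg : (Submodule.map (LinearMap.toSpanSingleton R X x) (a ^ n)).FG :=
    Submodule.FG.map _ ha.pow
  obtain ⟨m, hm⟩ := exists_pow_smul_eq_zero_of_fg a hfg (by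
    rintro _ ⟨r, hr, rfl⟩
    exact h r hr)
  refine ⟨m + n, fun r hr ↦ ?_⟩
  rw [pow_add] at hr
  refine Submodule.mul_induction_on hr (fun s hs t ht ↦ ?_) (fun s t hs ht ↦ ?_)
  · rw [mul_smul]
    exact hm s hs _ ⟨t, ht, rfl⟩
  · rw [add_smul, hs, ht, add_zero]

lemma exists_injective_embedding (X : Type u) [AddCommGroup X] [Module R X] :
    ∃ (I : Type u) (_ : AddCommGroup I) (_ : Module R I) (_ : Module.Injective R I)
      (f : X →ₗ[R] I), Function.Injective f :=
  let Y : ModuleCat.{u} R := ModuleCat.of R X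
  let I : ModuleCat.{u} R := CategoryTheory.Injective.under Y
  let f : Y ⟶ I := CategoryTheory.Injective.ι Y
  have : CategoryTheory.Injective (ModuleCat.of R I) := CategoryTheory.Injective.injective_under Y
  have := Module.injective_module_of_injective_object R I
  ⟨I, inferInstance, inferInstance, this, f.hom, (ModuleCat.mono_iff_injective _).1 inferInstance⟩

lemma LocCoh.mem_powTorsion (i : ℕ) (x : LocCoh a i X) : x ∈ powTorsion a (LocCoh a i X) := by
  induction i generalizing X with
  | zero =>
    obtain ⟨n, hn⟩ := (LocCoh.mem_range_ι a _).1 ⟨x, rfl⟩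
    refine ⟨n, fun r hr ↦ LocCoh.ι_injective a ?_⟩
    rw [map_smul, hn r hr, map_zero]
  | succ i ih =>
    obtain ⟨I, _, _, _, f, hf⟩ := exists_injective_embedding (R := R) X
    obtain ⟨-, δ, -, h₂⟩ := LocCoh.exists_connecting a hf
      (LinearMap.exact_map_mkQ_range f) (Submodule.mkQ_surjective _) i
    obtain ⟨y, rfl⟩ := (h₂ x).1 (Subsingleton.elim _ _)
    obtain ⟨n, hn⟩ := ih y
    exact ⟨n, fun r hr ↦ by rw [← map_smul, hn r hr, map_zero]⟩

lemma LocCoh.subsingleton_zero (h : powTorsion a X = ⊥) : Subsingleton (LocCoh a 0 X) :=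
  have : Subsingleton (powTorsion a X) := by rw [h]; infer_instance
  (LocCoh.zeroEquiv a).toEquiv.subsingleton

/-- Local cohomology of a zero module vanishes. -/
instance LocCoh.subsingleton [Subsingleton X] (i : ℕ) : Subsingleton (LocCoh a i X) := by
  cases i with
  | zero => exact (LocCoh.ι_injective a (X := X)).subsingleton
  | succ i =>
    have : Module.Injective R X := ⟨fun _ _ _ _ _ _ _ _ _ ↦ ⟨0, fun _ ↦ Subsingleton.elim _ _⟩⟩
    infer_instance

section Noetherian

variable [IsNoetherianRing R]

instance powTorsion_injective [Module.Injective R X] : Module.Injective R (powTorsion a X) := by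
  refine Module.Baer.injective fun J φ ↦ ?_
  obtain ⟨n, hn⟩ := exists_pow_smul_eq_zero_of_fg a
    (N := LinearMap.range ((powTorsion a X).subtype ∘ₗ φ))
    (by
      rw [← Submodule.map_top]
      exact (Module.Finite.fg_top (R := R) (M := J)).map _)
    (by rintro _ ⟨x, rfl⟩; exact (φ x).2)
  obtain ⟨k, hk⟩ := Ideal.exists_pow_inf_eq_pow_smul a J
  have hle : a ^ (n + k) ⊓ J ≤ a ^ n * J := by
    have := hk (n + k) (Nat.le_add_left _ _)
    simp only [smul_eq_mul, Ideal.mul_top, Nat.add_sub_cancel] at this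
    rw [this]
    exact Ideal.mul_mono_right inf_le_right
  have hzero (x : J) (hx : (x : R) ∈ a ^ (n + k)) : φ x = 0 := by
    have hx' : (x : R) ∈ a ^ n • J := hle ⟨hx, x.2⟩
    have : x ∈ (a ^ n • ⊤ : Submodule R J) := by
      have h : (x : R) ∈ Submodule.map J.subtype (a ^ n • ⊤ : Submodule R J) := by
        rwa [Submodule.map_smul'', Submodule.map_subtype_top]
      obtain ⟨y, hy, hyx⟩ := h
      rwa [← Subtype.ext hyx]
    refine Submodule.smul_induction_on this (fun r hr y _ ↦ ?_) (fun y z hy hz ↦ ?_)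
    · rw [map_smul]
      exact Subtype.ext (hn r hr _ ⟨y, rfl⟩)
    · rw [map_add, hy, hz, add_zero]
  let K : Submodule R J := Submodule.comap J.subtype (a ^ (n + k))
  let j : (J ⧸ K) →ₗ[R] R ⧸ a ^ (n + k) := Submodule.mapQ K (a ^ (n + k)) J.subtype le_rfl
  have hj : Function.Injective j := by
    rw [← LinearMap.ker_eq_bot, Submodule.ker_mapQ, Submodule.mkQ_map_self]
  obtain ⟨h, hh⟩ := Module.Injective.out j hj ((powTorsion a X).subtype ∘ₗ K.liftQ φ hzero)
  refine ⟨LinearMap.codRestrict (powTorsion a X) (h ∘ₗ Submodule.mkQ _) fun r ↦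
    ⟨n + k, fun s hs ↦ ?_⟩,
    fun x hx ↦ Subtype.ext ?_⟩
  · rw [← map_smul, LinearMap.comp_apply, Submodule.mkQ_apply, smul_eq_mul,
      (Submodule.Quotient.mk_eq_zero _).2 (Ideal.mul_mem_right r _ hs : s * r ∈ a ^ (n + k)),
      map_zero]
  · exact hh (Submodule.Quotient.mk ⟨x, hx⟩)

lemma powTorsion_quotient_eq_bot : powTorsion a (X ⧸ powTorsion a X) = ⊥ := by
  rw [eq_bot_iff]
  intro x
  obtain ⟨x, rfl⟩ := Submodule.mkQ_surjective _ x
  rintro ⟨n, hn⟩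
  refine (Submodule.Quotient.mk_eq_zero _).2 ?_
  refine mem_powTorsion_of_pow_smul_mem a (IsNoetherian.noetherian a) n fun r hr ↦ ?_
  rw [← Submodule.Quotient.mk_eq_zero]
  exact hn r hr

/-- Torsion modules have no higher local cohomology. -/
lemma LocCoh.subsingleton_succ_of_powTorsion_eq_top (h : powTorsion a X = ⊤) (i : ℕ) :
    Subsingleton (LocCoh a (i + 1) X) := by
  induction i generalizing X with
  | zero =>
    obtain ⟨I, _, _, _, f, hf⟩ := exists_injective_embedding (R := R) X
    obtain ⟨-, δ, h₁, h₂⟩ := LocCoh.exists_connecting a hf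
      (LinearMap.exact_map_mkQ_range f) (Submodule.mkQ_surjective _) 0
    refine subsingleton_of_forall_eq 0 fun x ↦ ?_
    obtain ⟨y, rfl⟩ := (h₂ x).1 (Subsingleton.elim _ _)
    refine (h₁ y).2 ?_
    obtain ⟨z, hz⟩ := Submodule.mkQ_surjective _ (LocCoh.ι a _ y)
    obtain ⟨n, hn⟩ := (LocCoh.mem_range_ι a _).1 ⟨y, rfl⟩
    have hz' : z ∈ powTorsion a I := by
      refine mem_powTorsion_of_pow_smul_mem a (IsNoetherian.noetherian a) n fun r hr ↦ ?_
      have := hn r hr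
      rw [← hz, ← map_smul] at this
      obtain ⟨x, hx⟩ := (Submodule.Quotient.mk_eq_zero _).1 this
      obtain ⟨m, hm⟩ : x ∈ powTorsion a X := h ▸ Submodule.mem_top
      exact ⟨m, fun s hs ↦ by rw [← hx, ← map_smul, hm s hs, map_zero]⟩
    obtain ⟨w, rfl⟩ := (LocCoh.mem_range_ι a _).2 hz'
    exact ⟨w, LocCoh.ι_injective a ((LocCoh.ι_map a _ _).trans hz)⟩
  | succ i ih =>
    obtain ⟨I, _, _, _, f, hf⟩ := exists_injective_embedding (R := R) X
    let f' : X →ₗ[R] powTorsion a I := LinearMap.codRestrict _ f fun x ↦ by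
      obtain ⟨m, hm⟩ : x ∈ powTorsion a X := h ▸ Submodule.mem_top
      exact ⟨m, fun s hs ↦ by rw [← map_smul, hm s hs, map_zero]⟩
    have hf' : Function.Injective f' := fun x y hxy ↦ hf congr(($hxy : I))
    have := ih (X := powTorsion a I ⧸ LinearMap.range f') <| by
      rw [eq_top_iff]
      rintro x -
      obtain ⟨x, rfl⟩ := Submodule.mkQ_surjective _ x
      obtain ⟨m, hm⟩ := x.2
      refine ⟨m, fun s hs ↦ ?_⟩
      rw [← map_smul, show s • x = 0 from Subtype.ext (hm s hs), map_zero]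
    obtain ⟨e⟩ := LocCoh.exists_linearEquiv_succ a hf' (LinearMap.exact_map_mkQ_range f')
      (Submodule.mkQ_surjective _) (i + 1)
    exact e.symm.toEquiv.subsingleton

/-- Higher local cohomology does not see the torsion submodule. -/
lemma LocCoh.exists_linearEquiv_quotient_powTorsion (i : ℕ) :
    Nonempty (LocCoh a (i + 1) X ≃ₗ[R] LocCoh a (i + 1) (X ⧸ powTorsion a X)) := by
  have ht : powTorsion a (powTorsion a X) = ⊤ := by
    rw [eq_top_iff]
    rintro ⟨x, n, hn⟩ -
    exact ⟨n, fun r hr ↦ Subtype.ext (hn r hr)⟩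
  obtain ⟨h₀, δ, h₁, h₂⟩ := LocCoh.exists_connecting a (powTorsion a X).injective_subtype
    (by simpa using LinearMap.exact_subtype_mkQ (powTorsion a X)) (Submodule.mkQ_surjective _)
    (i + 1)
  have := LocCoh.subsingleton_succ_of_powTorsion_eq_top a ht i
  have := LocCoh.subsingleton_succ_of_powTorsion_eq_top a ht (i + 1)
  refine ⟨LinearEquiv.ofBijective (LocCoh.map a (i + 1) (powTorsion a X).mkQ)
    ⟨?_, fun x ↦ (h₁ x).1 (Subsingleton.elim _ _)⟩⟩
  rw [injective_iff_map_eq_zero]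
  intro x hx
  obtain ⟨y, rfl⟩ := (h₀ x).1 hx
  rw [Subsingleton.elim y 0, map_zero]

end Noetherian

end LocCoh

section LocCohLocalization

variable {R : Type u} [CommRing R] (S : Submonoid R) (a : Ideal R)

lemma LocalizedModule.mk_eq_zero_iff {X : Type*} [AddCommGroup X] [Module R X] (x : X) (s : S) :
    LocalizedModule.mk x s = 0 ↔ ∃ t : S, t • x = 0 := by
  rw [← LocalizedModule.zero_mk 1, LocalizedModule.mk_eq]
  simp

/-- Right exact sequences with isomorphic presentations have isomorphic cokernels. -/
lemma nonempty_linearEquiv_of_presentations {X Y Z X' Y' Z' : Type*} [AddCommGroup X]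
    [AddCommGroup Y] [AddCommGroup Z] [AddCommGroup X'] [AddCommGroup Y'] [AddCommGroup Z']
    [Module R X] [Module R Y] [Module R Z] [Module R X'] [Module R Y'] [Module R Z']
    {f : X →ₗ[R] Y} {g : Y →ₗ[R] Z} {f' : X' →ₗ[R] Y'} {g' : Y' →ₗ[R] Z'}
    (h : Function.Exact f g) (hg : Function.Surjective g) (h' : Function.Exact f' g')
    (hg' : Function.Surjective g') (eX : X ≃ₗ[R] X') (eY : Y ≃ₗ[R] Y')
    (he : ∀ x, eY (f x) = f' (eX x)) : Nonempty (Z ≃ₗ[R] Z') := by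
  refine ⟨(g.quotKerEquivOfSurjective hg).symm.trans
    ((Submodule.Quotient.equiv _ _ eY ?_).trans (g'.quotKerEquivOfSurjective hg'))⟩
  rw [h.linearMap_ker_eq, h'.linearMap_ker_eq]
  ext y
  constructor
  · rintro ⟨_, ⟨x, rfl⟩, rfl⟩
    exact ⟨eX x, (he x).symm⟩
  · rintro ⟨x, rfl⟩
    exact ⟨_, ⟨eX.symm x, rfl⟩, by simpa using he (eX.symm x)⟩

variable {X Y : Type u} [AddCommGroup X] [Module R X] [AddCommGroup Y] [Module R Y]

lemma mk_mem_powTorsion (ha : a.FG) (x : X) (s : S) :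
    LocalizedModule.mk x s ∈ powTorsion (a.map (algebraMap R (Localization S)))
      (LocalizedModule S X) ↔ ∃ t : S, t • x ∈ powTorsion a X := by
  constructor
  · rintro ⟨n, hn⟩
    have h : ∀ r ∈ a ^ n, ∃ t : S, t • r • x = 0 := fun r hr ↦ by
      rw [← LocalizedModule.mk_eq_zero_iff S (r • x) s, ← LocalizedModule.smul'_mk]
      rw [← hn (algebraMap R _ r) (by
        rw [← Ideal.map_pow]; exact Ideal.mem_map_of_mem _ hr), algebraMap_smul]
    have hfg : (a ^ n).FG := ha.pow
    have h' : ∃ t : S, ∀ r ∈ a ^ n, t • r • x = 0 := by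
      obtain ⟨G, hG⟩ := hfg
      choose! t ht using h
      classical
      refine ⟨∏ g ∈ G, t g, fun r hr ↦ ?_⟩
      rw [← hG] at hr
      induction hr using Submodule.span_induction with
      | mem g hg =>
        rw [← Finset.prod_erase_mul _ _ hg, mul_smul, ht g (hG ▸ Submodule.subset_span hg),
          smul_zero]
      | zero => rw [zero_smul, smul_zero]
      | add y z _ _ hy hz => rw [add_smul, smul_add, hy, hz, add_zero]
      | smul c y _ hy => rw [smul_assoc, smul_comm, hy, smul_zero]
    obtain ⟨t, ht⟩ := h'
    exact ⟨t, n, fun r hr ↦ by rw [smul_comm, ht r hr]⟩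
  · rintro ⟨t, n, hn⟩
    refine ⟨n, fun r hr ↦ ?_⟩
    rw [← Ideal.map_pow] at hr
    refine Submodule.span_induction (p := fun r _ ↦ r • LocalizedModule.mk x s = 0) ?_ ?_ ?_ ?_ hr
    · rintro _ ⟨r, hr, rfl⟩
      rw [algebraMap_smul, LocalizedModule.smul'_mk, LocalizedModule.mk_eq_zero_iff]
      exact ⟨t, by rw [smul_comm, hn r hr]⟩
    · rw [zero_smul]
    · intro y z _ _ hy hz
      rw [add_smul, hy, hz, add_zero]
    · intro c y _ hy
      rw [smul_assoc, hy, smul_zero]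

variable (X) in
/-- The zeroth local cohomology commutes with localization. -/
noncomputable def LocCoh.localizationZeroEquiv (ha : a.FG) :
    LocalizedModule S (LocCoh a 0 X) ≃ₗ[Localization S]
      LocCoh (a.map (algebraMap R (Localization S))) 0 (LocalizedModule S X) :=
  (LinearEquiv.ofInjective (LocalizedModule.map S (LocCoh.ι a X))
    (LocalizedModule.map_injective S _ (LocCoh.ι_injective a))).trans <|
    (LinearEquiv.ofEq _ _ (by
      rw [range_ι_eq_powTorsion]
      ext z
      obtain ⟨⟨x, s⟩, rfl⟩ := IsLocalizedModule.mk'_surjective S (LocalizedModule.mkLinearMap S X) z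
      rw [Function.uncurry_apply_pair, ← IsLocalizedModule.mk_eq_mk', mk_mem_powTorsion S a ha]
      constructor
      · rintro ⟨w, hw⟩
        obtain ⟨⟨y, t⟩, rfl⟩ :=
          IsLocalizedModule.mk'_surjective S (LocalizedModule.mkLinearMap S (LocCoh a 0 X)) w
        rw [Function.uncurry_apply_pair, ← IsLocalizedModule.mk_eq_mk',
          LocalizedModule.map_mk, LocalizedModule.mk_eq] at hw
        obtain ⟨u, hu⟩ := hw
        refine ⟨u * t, ?_⟩
        rw [mul_smul, ← hu, ← range_ι_eq_powTorsion]
        exact Submodule.smul_mem _ (u : R) (Submodule.smul_mem _ (s : R) ⟨y, rfl⟩)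
      · rintro ⟨t, ht⟩
        rw [← range_ι_eq_powTorsion] at ht
        obtain ⟨y, hy⟩ := ht
        refine ⟨LocalizedModule.mk y (t * s), ?_⟩
        rw [LocalizedModule.map_mk, hy, LocalizedModule.mk_cancel_common_left])).trans
    (LinearEquiv.ofInjective (LocCoh.ι _ (LocalizedModule S X)) (LocCoh.ι_injective _)).symm

lemma LocCoh.ι_localizationZeroEquiv (ha : a.FG) (x : LocalizedModule S (LocCoh a 0 X)) :
    LocCoh.ι _ (LocalizedModule S X) (LocCoh.localizationZeroEquiv S a X ha x) =
      LocalizedModule.map S (LocCoh.ι a X) x := by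
  have := LinearEquiv.apply_symm_apply (LinearEquiv.ofInjective
    (LocCoh.ι (a.map (algebraMap R (Localization S))) (LocalizedModule S X)) (LocCoh.ι_injective _))
  exact congrArg Subtype.val (this _)

lemma LocCoh.localizationZeroEquiv_naturality (ha : a.FG) (f : X →ₗ[R] Y)
    (x : LocalizedModule S (LocCoh a 0 X)) :
    LocCoh.localizationZeroEquiv S a Y ha (LocalizedModule.map S (LocCoh.map a 0 f) x) =
      LocCoh.map _ 0 (LocalizedModule.map S f) (LocCoh.localizationZeroEquiv S a X ha x) := by
  refine LocCoh.ι_injective _ ?_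
  rw [LocCoh.ι_map, LocCoh.ι_localizationZeroEquiv, LocCoh.ι_localizationZeroEquiv]
  obtain ⟨⟨x, s⟩, rfl⟩ := IsLocalizedModule.mk'_surjective S (LocalizedModule.mkLinearMap S _) x
  rw [Function.uncurry_apply_pair, ← IsLocalizedModule.mk_eq_mk']
  simp only [LocalizedModule.map_mk, LocCoh.ι_map]

/-- Local cohomology commutes with localization. -/
lemma LocCoh.nonempty_localization_linearEquiv [IsNoetherianRing R] (i : ℕ) :
    Nonempty (LocalizedModule S (LocCoh a i X) ≃ₗ[Localization S]
      LocCoh (a.map (algebraMap R (Localization S))) i (LocalizedModule S X)) := by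
  have ha : a.FG := IsNoetherian.noetherian a
  induction i generalizing X with
  | zero => exact ⟨LocCoh.localizationZeroEquiv S a X ha⟩
  | succ i ih =>
    obtain ⟨I, _, _, _, f, hf⟩ := exists_injective_embedding (R := R) X
    have hfg := LinearMap.exact_map_mkQ_range f
    have hg := Submodule.mkQ_surjective (LinearMap.range f)
    have hf' := LocalizedModule.map_injective S f hf
    have hfg' : Function.Exact (LocalizedModule.map S f)
        (LocalizedModule.map S (LinearMap.range f).mkQ) :=
      LocalizedModule.map_exact S _ _ hfg
    have hg' := LocalizedModule.map_surjective S _ hg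
    have : Module.Injective (Localization S) (LocalizedModule S I) :=
      Module.injective_of_isLocalizedModule S (LocalizedModule.mkLinearMap S I)
    cases i with
    | zero =>
      obtain ⟨-, δ, h₁, h₂⟩ := LocCoh.exists_connecting a hf hfg hg 0
      obtain ⟨-, δ', h₁', h₂'⟩ := LocCoh.exists_connecting
        (a.map (algebraMap R (Localization S))) hf' hfg' hg' 0
      have hδ : Function.Surjective δ := fun x ↦ (h₂ x).1 (Subsingleton.elim _ _)
      exact nonempty_linearEquiv_of_presentations (LocalizedModule.map_exact S _ _ h₁)
        (LocalizedModule.map_surjective S _ hδ) h₁' (fun x ↦ (h₂' x).1 (Subsingleton.elim _ _))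
        (LocCoh.localizationZeroEquiv S a _ ha) (LocCoh.localizationZeroEquiv S a _ ha)
        (LocCoh.localizationZeroEquiv_naturality S a ha _)
    | succ i =>
      obtain ⟨e⟩ := LocCoh.exists_linearEquiv_succ a hf hfg hg (i + 1)
      obtain ⟨e'⟩ := LocCoh.exists_linearEquiv_succ
        (a.map (algebraMap R (Localization S))) hf' hfg' hg' (i + 1)
      obtain ⟨e''⟩ := ih (X := I ⧸ LinearMap.range f)
      exact ⟨(LinearEquiv.ofBijective (LocalizedModule.map S e.symm.toLinearMap)
        ⟨LocalizedModule.map_injective S _ e.symm.injective,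
          LocalizedModule.map_surjective S _ e.symm.surjective⟩).trans (e''.trans e')⟩

end LocCohLocalization

section WeaklyLaskerian

lemma Submodule.mapQ_injective_of_eq_comap {R X Y : Type*} [Ring R] [AddCommGroup X] [Module R X]
    [AddCommGroup Y] [Module R Y] (f : X →ₗ[R] Y) {N : Submodule R X} {P : Submodule R Y}
    (h : N = P.comap f) : Function.Injective (N.mapQ P f h.le) := by
  rw [← LinearMap.ker_eq_bot, Submodule.mapQ, Submodule.ker_liftQ_eq_bot']
  rw [LinearMap.ker_comp, Submodule.ker_mkQ, h]

/-- Every quotient has only finitely many associated primes. -/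
def IsWeaklyLaskerian (R X : Type*) [CommRing R] [AddCommGroup X] [Module R X] : Prop :=
  ∀ N : Submodule R X, (associatedPrimes R (X ⧸ N)).Finite

namespace IsWeaklyLaskerian

variable {R : Type*} [CommRing R] {X Y Z : Type*} [AddCommGroup X] [Module R X]
  [AddCommGroup Y] [Module R Y] [AddCommGroup Z] [Module R Z]

lemma of_injective {f : X →ₗ[R] Y} (hf : Function.Injective f) (h : IsWeaklyLaskerian R Y) :
    IsWeaklyLaskerian R X := fun N ↦
  (h (N.map f)).subset <| associatedPrimes.subset_of_injective
    (f := N.mapQ (N.map f) f (Submodule.le_comap_map f N))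
    (Submodule.mapQ_injective_of_eq_comap f (Submodule.comap_map_eq_of_injective hf N).symm)

lemma of_surjective {f : X →ₗ[R] Y} (hf : Function.Surjective f) (h : IsWeaklyLaskerian R X) :
    IsWeaklyLaskerian R Y := fun N ↦ by
  refine (h (N.comap f)).subset <| associatedPrimes.subset_of_injective
    (f := (LinearEquiv.ofBijective ((N.comap f).mapQ N f le_rfl) ⟨?_, ?_⟩).symm.toLinearMap)
    (LinearEquiv.injective _)
  · exact Submodule.mapQ_injective_of_eq_comap f rfl
  · rw [← LinearMap.range_eq_top, Submodule.mapQ, Submodule.range_liftQ, LinearMap.range_comp,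
      LinearMap.range_eq_top.2 hf, Submodule.map_top, Submodule.range_mkQ]

lemma of_linearEquiv (e : X ≃ₗ[R] Y) (h : IsWeaklyLaskerian R X) : IsWeaklyLaskerian R Y :=
  h.of_surjective (f := e.toLinearMap) e.surjective

lemma of_exact {f : X →ₗ[R] Y} {g : Y →ₗ[R] Z} (hfg : Function.Exact f g)
    (hX : IsWeaklyLaskerian R X) (hZ : IsWeaklyLaskerian R Z) : IsWeaklyLaskerian R Y := fun N ↦ by
  refine ((hX (N.comap f)).union (hZ (N.map g))).subset <| associatedPrimes.subset_union_of_exact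
    (f := (N.comap f).mapQ N f le_rfl)
    (g := N.mapQ (N.map g) g (Submodule.le_comap_map g N)) ?_ ?_
  · exact Submodule.mapQ_injective_of_eq_comap f rfl
  · intro y
    obtain ⟨y, rfl⟩ := Submodule.mkQ_surjective _ y
    constructor
    · intro hy
      obtain ⟨n, hn, hny⟩ := (Submodule.Quotient.mk_eq_zero _).1 hy
      obtain ⟨x, hx⟩ := (hfg (y - n)).1 (by rw [map_sub, hny, sub_self])
      refine ⟨Submodule.Quotient.mk x, ?_⟩
      rw [Submodule.mapQ_apply, hx, Submodule.mkQ_apply, Submodule.Quotient.eq]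
      simpa using hn
    · rintro ⟨x, hx⟩
      obtain ⟨x, rfl⟩ := Submodule.mkQ_surjective _ x
      rw [← hx]
      simp [hfg.apply_apply_eq_zero]

lemma of_range_le {f : X →ₗ[R] Y} {g : Z →ₗ[R] Y} (hf : Function.Injective f)
    (hfg : LinearMap.range f ≤ LinearMap.range g) (h : IsWeaklyLaskerian R Z) :
    IsWeaklyLaskerian R X :=
  (h.of_surjective g.surjective_rangeRestrict).of_injective
    (f := f.codRestrict (LinearMap.range g) fun x ↦ hfg ⟨x, rfl⟩)
    (fun _ _ hxy ↦ hf congr(($hxy).1))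

lemma of_subsingleton [Subsingleton X] : IsWeaklyLaskerian R X := fun N ↦ by
  rw [associatedPrimes.eq_empty_of_subsingleton]
  exact Set.finite_empty

lemma of_finite [IsNoetherianRing R] [Module.Finite R X] : IsWeaklyLaskerian R X := fun _ ↦
  associatedPrimes.finite R _

lemma pi_fin (h : IsWeaklyLaskerian R X) (n : ℕ) : IsWeaklyLaskerian R (Fin n → X) := by
  induction n with
  | zero => exact of_subsingleton
  | succ n ih =>
    have h₁ : IsWeaklyLaskerian R (X × (Fin n → X)) :=
      of_exact (f := LinearMap.inl R X (Fin n → X)) (g := LinearMap.snd R X (Fin n → X))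
        (fun y ↦ ⟨fun hy ↦ ⟨y.1, Prod.ext rfl hy.symm⟩, by rintro ⟨x, rfl⟩; rfl⟩) h ih
    exact h₁.of_linearEquiv (Fin.consLinearEquiv R (fun _ : Fin (n + 1) ↦ X))

lemma linearMap {N : Type*} [AddCommGroup N] [Module R N] [Module.Finite R N]
    (h : IsWeaklyLaskerian R X) : IsWeaklyLaskerian R (N →ₗ[R] X) := by
  obtain ⟨n, f, hf⟩ := Module.Finite.exists_fin' R N
  refine (h.pi_fin n).of_injective
    (f := (LinearEquiv.piRing R X (Fin n) R).toLinearMap ∘ₗ LinearMap.lcomp R X f) ?_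
  exact (LinearEquiv.piRing R X (Fin n) R).injective.comp fun φ ψ hφ ↦
    (LinearMap.cancel_right hf).1 hφ

lemma of_forall_smul_mem [IsNoetherianRing R] (b : Ideal R) {Z : Submodule R X}
    (hb : ∀ r ∈ b, ∀ x : X, r • x ∈ Z) (h : IsWeaklyLaskerian R (Submodule.torsionBySet R X b))
    (hZ : IsWeaklyLaskerian R Z) : IsWeaklyLaskerian R X := by
  obtain ⟨m, v, rfl⟩ := Submodule.fg_iff_exists_fin_generating_family.1
    (IsNoetherian.noetherian b)
  let g : X →ₗ[R] (Fin m → Z) := LinearMap.pi fun i ↦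
    (v i • LinearMap.id).codRestrict Z (hb (v i) (Submodule.subset_span ⟨i, rfl⟩))
  refine of_exact (f := Submodule.subtype _) (g := g) (fun x ↦ ?_) h (hZ.pi_fin m)
  rw [← LinearMap.coe_range, SetLike.mem_coe, Submodule.range_subtype,
    Submodule.mem_torsionBySet_iff]
  have : g x = 0 ↔ ∀ i, v i • x = 0 := by
    simp [g, funext_iff, Subtype.ext_iff]
  rw [this]
  constructor
  · rintro hx ⟨r, hr⟩
    change r • x = 0
    induction hr using Submodule.span_induction with
    | mem r hr => obtain ⟨i, rfl⟩ := hr; exact hx i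
    | zero => simp
    | add r s _ _ hr hs => rw [add_smul, hr, hs, add_zero]
    | smul c r _ hr => rw [smul_eq_mul, mul_smul, hr, smul_zero]
  · exact fun hx i ↦ hx ⟨v i, Submodule.subset_span ⟨i, rfl⟩⟩

lemma torsionBySet_pow [IsNoetherianRing R] (a : Ideal R)
    (h : IsWeaklyLaskerian R (Submodule.torsionBySet R X a)) (n : ℕ) :
    IsWeaklyLaskerian R (Submodule.torsionBySet R X (a ^ n : Ideal R)) := by
  induction n with
  | zero =>
    have : Subsingleton (Submodule.torsionBySet R X (a ^ 0 : Ideal R)) := by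
      refine subsingleton_of_forall_eq 0 fun x ↦ Subtype.ext ?_
      simpa using (Submodule.mem_torsionBySet_iff _ _).1 x.2 ⟨1, by simp⟩
    exact of_subsingleton
  | succ n ih =>
    let T := Submodule.torsionBySet R X (a ^ (n + 1) : Ideal R)
    have hinj (N : Submodule R T) : Function.Injective (T.subtype ∘ₗ N.subtype) :=
      T.subtype_injective.comp N.subtype_injective
    refine of_forall_smul_mem (a ^ n) (Z := (Submodule.torsionBySet R X a).comap T.subtype)
      (fun r hr x ↦ ?_) (of_range_le (hinj _) (g := Submodule.subtype _) ?_ ih)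
      (of_range_le (hinj _) (g := Submodule.subtype _) ?_ h)
    · rw [Submodule.mem_comap, Submodule.mem_torsionBySet_iff]
      rintro ⟨s, hs⟩
      simpa [smul_smul] using (Submodule.mem_torsionBySet_iff _ _).1 x.2
        ⟨s * r, by simpa [pow_succ'] using Ideal.mul_mem_mul hs hr⟩
    · rw [Submodule.range_subtype]
      rintro _ ⟨x, rfl⟩
      exact (Submodule.mem_torsionBySet_iff _ _).2 fun r ↦
        congr(($((Submodule.mem_torsionBySet_iff _ _).1 x.2 r)).1)
    · rw [Submodule.range_subtype]
      rintro _ ⟨x, rfl⟩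
      exact x.2

end IsWeaklyLaskerian

end WeaklyLaskerian

section ExtWeaklyLaskerian

open Abelian

variable {R : Type u} [CommRing R]

lemma IsWeaklyLaskerian.ext [IsNoetherianRing R] (N : ModuleCat.{u} R) [Module.Finite R N]
    {M : ModuleCat.{u} R} (h : IsWeaklyLaskerian R M) (i : ℕ) :
    IsWeaklyLaskerian R (Ext N M i) := by
  induction i generalizing N with
  | zero =>
    exact (h.linearMap (N := N)).of_linearEquiv
      (Ext.linearEquiv₀.trans ModuleCat.homLinearEquiv).symm
  | succ n ih =>
    obtain ⟨P, _, _, _, _, f, surjf⟩ := Module.exists_finite_presentation R N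
    let exac := LinearMap.shortExact_shortComplexKer surjf
    exact (ih _).of_surjective (f := exac.extClass.precompOfLinear R M (add_comm 1 n))
      (precomp_extClass_surjective_of_projective_X₂ M exac n)

lemma IsWeaklyLaskerian.ext_of_shortExact {S : ShortComplex (ModuleCat.{u} R)} (hS : S.ShortExact)
    (N : ModuleCat.{u} R) (i : ℕ) (h₂ : IsWeaklyLaskerian R (Ext N S.X₂ i))
    (h₁ : IsWeaklyLaskerian R (Ext N S.X₁ (i + 1))) : IsWeaklyLaskerian R (Ext N S.X₃ i) :=
  of_exact (f := (Ext.mk₀ S.g).postcompOfLinear R N (add_zero i))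
    (g := hS.extClass.postcompOfLinear R N rfl)
    (fun x ↦ ⟨fun hx ↦ Ext.covariant_sequence_exact₃ N hS x rfl hx, by
      rintro ⟨y, rfl⟩
      change (y.comp (Ext.mk₀ S.g) (add_zero i)).comp hS.extClass rfl = 0
      simp⟩) h₂ h₁

end ExtWeaklyLaskerian

section TorsionWeaklyLaskerian

open Abelian

variable {R : Type u} [CommRing R] (a : Ideal R)

lemma subsingleton_linearMap_of_powTorsion_eq_bot {E : Type u} [AddCommGroup E] [Module R E]
    (h : powTorsion a E = ⊥) : Subsingleton ((R ⧸ a) →ₗ[R] E) := by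
  refine subsingleton_of_forall_eq 0 fun φ ↦ LinearMap.ext fun x ↦ ?_
  rw [LinearMap.zero_apply, ← Submodule.mem_bot R, ← h]
  refine ⟨1, fun r hr ↦ ?_⟩
  obtain ⟨x, rfl⟩ := Ideal.Quotient.mk_surjective x
  rw [pow_one] at hr
  rw [← map_smul, Algebra.smul_def, Ideal.Quotient.algebraMap_eq,
    Ideal.Quotient.eq_zero_iff_mem.2 hr,
    zero_mul, map_zero]

lemma IsWeaklyLaskerian.torsionBySet_of_linearEquiv {X Y : Type*} [AddCommGroup X] [Module R X]
    [AddCommGroup Y] [Module R Y] (e : X ≃ₗ[R] Y)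
    (h : IsWeaklyLaskerian R (Submodule.torsionBySet R X a)) :
    IsWeaklyLaskerian R (Submodule.torsionBySet R Y a) :=
  of_range_le (f := (Submodule.torsionBySet R Y a).subtype)
    (g := e.toLinearMap ∘ₗ (Submodule.torsionBySet R X a).subtype) (Submodule.subtype_injective _)
    (by
      rintro _ ⟨y, rfl⟩
      refine ⟨⟨e.symm y, (Submodule.mem_torsionBySet_iff _ _).2 fun r ↦ ?_⟩, by simp⟩
      rw [← map_smul, (Submodule.mem_torsionBySet_iff _ _).1 y.2 r, map_zero]) h

variable [IsNoetherianRing R]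

instance injective_quotient_powTorsion (I : Type u) [AddCommGroup I] [Module R I]
    [Module.Injective R I] : Module.Injective R (I ⧸ powTorsion a I) := by
  obtain ⟨r, hr⟩ := Module.Injective.out (powTorsion a I).subtype
    (Submodule.subtype_injective _) LinearMap.id
  let s : (I ⧸ powTorsion a I) →ₗ[R] I := (powTorsion a I).liftQ
    (LinearMap.id - (powTorsion a I).subtype ∘ₗ r) (fun x hx ↦ by
      simpa [sub_eq_zero] using congr((($(hr ⟨x, hx⟩)).1 : I)).symm)
  have hs (y : I ⧸ powTorsion a I) : (powTorsion a I).mkQ (s y) = y := by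
    obtain ⟨y, rfl⟩ := Submodule.mkQ_surjective _ y
    simp [s]
  refine ⟨fun X Y _ _ _ _ f hf g ↦ ?_⟩
  obtain ⟨h, hh⟩ := Module.Injective.out f hf (s ∘ₗ g)
  exact ⟨(powTorsion a I).mkQ ∘ₗ h, fun x ↦ by simp [hh, hs]⟩

lemma torsionBySet_locCoh_isWeaklyLaskerian (j : ℕ) (M : Type u) [AddCommGroup M] [Module R M]
    (hExt : ∀ i ≤ j, IsWeaklyLaskerian R (Ext (ModuleCat.of R (R ⧸ a)) (ModuleCat.of R M) i))
    (hM : ∀ i < j, IsWeaklyLaskerian R (LocCoh a i M)) :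
    IsWeaklyLaskerian R (Submodule.torsionBySet R (LocCoh a j M) a) := by
  induction j generalizing M with
  | zero =>
    have h₀ : IsWeaklyLaskerian R ((R ⧸ a) →ₗ[R] M) := (hExt 0 le_rfl).of_linearEquiv
      (Ext.linearEquiv₀.trans ModuleCat.homLinearEquiv)
    refine IsWeaklyLaskerian.of_range_le
      (f := LocCoh.ι a M ∘ₗ (Submodule.torsionBySet R (LocCoh a 0 M) a).subtype)
      (g := LinearMap.applyₗ (1 : R ⧸ a))
      ((LocCoh.ι_injective a).comp (Submodule.subtype_injective _)) ?_ h₀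
    rintro _ ⟨x, rfl⟩
    refine ⟨Submodule.liftQ a (LinearMap.toSpanSingleton R M (LocCoh.ι a M x)) fun r hr ↦ ?_, ?_⟩
    · rw [LinearMap.mem_ker, LinearMap.toSpanSingleton_apply, ← map_smul]
      rw [(Submodule.mem_torsionBySet_iff _ _).1 x.2 ⟨r, hr⟩, map_zero]
    · change LinearMap.toSpanSingleton R M (LocCoh.ι a M x) 1 = _
      simp
  | succ j ih =>
    obtain ⟨I, _, _, _, f, hf⟩ := exists_injective_embedding (R := R) M
    let M' := M ⧸ powTorsion a M
    let E := I ⧸ powTorsion a I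
    have hker : (powTorsion a M) = (powTorsion a I).comap f := by
      ext x
      simp only [Submodule.mem_comap, mem_powTorsion, ← map_smul, map_eq_zero_iff f hf]
    let f' : M' →ₗ[R] E := (powTorsion a M).mapQ _ f hker.le
    have hf' : Function.Injective f' := Submodule.mapQ_injective_of_eq_comap f hker
    have hE : powTorsion a E = ⊥ := powTorsion_quotient_eq_bot a
    have := LocCoh.subsingleton_zero a hE
    have hsub (i : ℕ) : Subsingleton (LocCoh a i E) := by
      cases i <;> infer_instance
    let C := E ⧸ LinearMap.range f'
    let g' : E →ₗ[R] C := (LinearMap.range f').mkQ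
    have hfg' : Function.Exact f' g' := LinearMap.exact_map_mkQ_range f'
    have hg' : Function.Surjective g' := Submodule.mkQ_surjective _
    have eC (i : ℕ) : Nonempty (LocCoh a i C ≃ₗ[R] LocCoh a (i + 1) M) :=
      ⟨(LocCoh.exists_linearEquiv_succ a hf' hfg' hg' i).some.trans
        (LocCoh.exists_linearEquiv_quotient_powTorsion a i).some.symm⟩
    refine (ih C (fun i hi ↦ ?_) (fun i hi ↦
      (hM (i + 1) (by lia)).of_linearEquiv (eC i).some.symm)).torsionBySet_of_linearEquiv a
      (eC j).some
    let S₁ : ShortComplex (ModuleCat.{u} R) := ShortComplex.mk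
      (ModuleCat.ofHom (powTorsion a M).subtype) (ModuleCat.ofHom (powTorsion a M).mkQ)
      (by ext x; simp)
    have hS₁ : S₁.ShortExact :=
      { exact := (ShortComplex.ShortExact.moduleCat_exact_iff_function_exact _).2
          (LinearMap.exact_subtype_mkQ _)
        mono_f := (ModuleCat.mono_iff_injective _).2 (Submodule.subtype_injective _)
        epi_g := (ModuleCat.epi_iff_surjective _).2 (Submodule.mkQ_surjective _) }
    let S₂ : ShortComplex (ModuleCat.{u} R) := ShortComplex.mk
      (ModuleCat.ofHom f') (ModuleCat.ofHom g') (ModuleCat.hom_ext hfg'.linearMap_comp_eq_zero)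
    have hS₂ : S₂.ShortExact :=
      { exact := (ShortComplex.ShortExact.moduleCat_exact_iff_function_exact _).2 hfg'
        mono_f := (ModuleCat.mono_iff_injective _).2 hf'
        epi_g := (ModuleCat.epi_iff_surjective _).2 hg' }
    have hM' : IsWeaklyLaskerian R (Ext (ModuleCat.of R (R ⧸ a)) (ModuleCat.of R M') (i + 1)) :=
      .ext_of_shortExact hS₁ _ _ (hExt (i + 1) (by lia))
        (.ext _ ((hM 0 (by lia)).of_linearEquiv (LocCoh.zeroEquiv a)) _)
    have hExtE : Subsingleton (Ext (ModuleCat.of R (R ⧸ a)) (ModuleCat.of R E) i) := by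
      cases i with
      | zero =>
        have := subsingleton_linearMap_of_powTorsion_eq_bot a hE
        exact (Ext.linearEquiv₀ (R := R).trans ModuleCat.homLinearEquiv).toEquiv.subsingleton
      | succ i =>
        have := Module.injective_object_of_injective_module R E
        exact Ext.subsingleton_of_injective _ _ _
    exact .ext_of_shortExact hS₂ _ _ .of_subsingleton hM'

end TorsionWeaklyLaskerian

section PrimeSequence

lemma infinite_setOf_height_eq_one (D : Type*) [CommRing D] [IsDomain D] [IsNoetherianRing D]
    [IsLocalRing D] (hD : 2 ≤ ringKrullDim D) :
    {q : Ideal D | q.IsPrime ∧ q.height = 1}.Infinite := by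
  intro hfin
  rw [← IsLocalRing.maximalIdeal_height_eq_ringKrullDim] at hD
  replace hD : 2 ≤ (IsLocalRing.maximalIdeal D).height := WithBot.coe_le_coe.1 hD
  have hsub : (IsLocalRing.maximalIdeal D : Set D) ⊆
      ⋃ q ∈ insert ⊥ {q : Ideal D | q.IsPrime ∧ q.height = 1}, (id q : Ideal D) := by
    intro x hx
    rw [Set.mem_iUnion₂]
    by_cases hx₀ : x = 0
    · exact ⟨⊥, Set.mem_insert _ _, hx₀⟩
    · obtain ⟨q, hq, -⟩ := Ideal.exists_minimalPrimes_le
        (show Ideal.span {x} ≤ IsLocalRing.maximalIdeal D by simpa [Ideal.span_le] using hx)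
      have := hq.isPrime
      have hxq : x ∈ q := hq.1.2 (Ideal.mem_span_singleton_self x)
      refine ⟨q, Set.mem_insert_of_mem _ ⟨this, le_antisymm
        (Ideal.height_le_one_of_isPrincipal_of_mem_minimalPrimes _ q hq) ?_⟩, hxq⟩
      rw [Order.one_le_iff_ne_zero, Ne, Ideal.height_eq_zero_iff_eq_bot]
      rintro rfl
      exact hx₀ hxq
  obtain ⟨q, hq, hle⟩ := (Ideal.subset_union_prime_finite (hfin.insert ⊥) ⊥ ⊥
    (by rintro q (rfl | hq) h <;> [exact absurd rfl h; exact fun _ ↦ hq.1])).1 hsub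
  have h₁ : (id q : Ideal D).height ≤ 1 := by
    obtain rfl | hq := hq
    · simp
    · exact hq.2.le
  exact absurd (hD.trans ((Ideal.height_mono hle).trans h₁)) (by decide)

variable {R : Type*} [CommRing R] [IsNoetherianRing R]

lemma exists_antichain_primes [IsLocalRing R] (p : Ideal R) [p.IsPrime]
    (hp : 2 ≤ ringKrullDim (R ⧸ p)) :
    ∃ q : ℕ → Ideal R, (∀ k, (q k).IsPrime) ∧ (∀ k, p ≤ q k) ∧ ∀ i j, q i ≤ q j → i = j := by
  have := IsLocalRing.of_surjective' (Ideal.Quotient.mk p) Ideal.Quotient.mk_surjective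
  have h := infinite_setOf_height_eq_one (R ⧸ p) hp
  let e := h.natEmbedding
  have hprime (k : ℕ) : (e k).1.IsPrime := (e k).2.1
  refine ⟨fun k ↦ (e k).1.comap (Ideal.Quotient.mk p), fun k ↦ inferInstance,
    fun k ↦ ?_, fun i j hij ↦ ?_⟩
  · intro x hx
    rw [Ideal.mem_comap, Ideal.Quotient.eq_zero_iff_mem.2 hx]
    exact zero_mem _
  · have hle := (Ideal.comap_le_comap_iff_of_surjective _ Ideal.Quotient.mk_surjective _ _).1 hij
    obtain heq | hlt := hle.eq_or_lt
    · exact e.injective (Subtype.ext heq)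
    · have := Ideal.height_strict_mono_of_isPrime_of_isPrime hlt
      rw [(e i).2.2, (e j).2.2] at this
      exact absurd this (lt_irrefl _)

lemma exists_colon_eq_of_isPrime {Y : Type*} [AddCommGroup Y] [Module R Y] [Module.Finite R Y]
    (W : Submodule R Y) (c : Ideal R) (hc : ∀ r ∈ c, ∀ w ∈ W, r • w = 0) (q : Ideal R)
    [q.IsPrime] (hcq : ¬ c ≤ q) (x : Y) (hx : ∀ r ∉ q, r • x ≠ 0) :
    ∃ (L : Submodule R Y) (n : ℕ), L ⊓ W = ⊥ ∧ (q * c ^ n) • ⊤ ≤ L ∧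
      ∃ y, ∀ r, r • y ∈ L ↔ r ∈ q := by
  obtain ⟨k, hk⟩ := Ideal.exists_pow_inf_eq_pow_smul c W
  let Z : Submodule R Y := c ^ (k + 1) • ⊤
  have hZW : Z ⊓ W = ⊥ := by
    rw [hk (k + 1) (by lia), eq_bot_iff, Nat.add_sub_cancel_left, pow_one, Submodule.smul_le]
    exact fun r hr w hw ↦ (Submodule.mem_bot R).2 (hc r hr w hw.2)
  obtain ⟨t, htc, htq⟩ := SetLike.not_le_iff_exists.1 hcq
  let Q : PrimeSpectrum R := ⟨q, inferInstance⟩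
  have hQZ : Q ∈ Module.support R Z := by
    rw [Module.mem_support_iff']
    refine ⟨⟨t ^ (k + 1) • x, Submodule.smul_mem_smul (Ideal.pow_mem_pow htc _)
      Submodule.mem_top⟩, fun r hr h ↦ hx (r * t ^ (k + 1)) ?_ ?_⟩
    · exact fun h ↦ (Ideal.IsPrime.mem_or_mem ‹_› h).elim hr
        fun h ↦ htq (Ideal.IsPrime.mem_of_pow_mem ‹_› _ h)
    · rw [mul_smul]
      exact congr(($h).1)
  have hQ : Q ∈ Module.support R (Z ⧸ (q • ⊤ : Submodule R Z)) := by
    rw [Module.support_quotient]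
    exact ⟨hQZ, le_refl q⟩
  rw [Module.mem_support_iff'] at hQ
  obtain ⟨y, hy⟩ := hQ
  obtain ⟨y, rfl⟩ := Submodule.mkQ_surjective _ y
  have hmap : (q • ⊤ : Submodule R Z).map Z.subtype = q • Z := by simp
  refine ⟨q • Z, k + 1, ?_, ?_, y, fun r ↦ ?_⟩
  · rw [eq_bot_iff, ← hZW]
    exact inf_le_inf_right _ Submodule.smul_le_right
  · rw [Submodule.mul_smul]
  · rw [← hmap]
    constructor
    · rintro ⟨z, hz, hzy⟩
      by_contra hr
      refine hy r hr ?_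
      rw [← map_smul, Submodule.mkQ_apply, Submodule.Quotient.mk_eq_zero]
      rwa [Subtype.ext (a1 := r • y) (a2 := z) hzy.symm]
    · exact fun hr ↦ ⟨r • y, Submodule.smul_mem_smul hr Submodule.mem_top, rfl⟩

end PrimeSequence

section LocallyFinite

variable {R : Type*} [CommRing R] [IsNoetherianRing R] {H : Type*} [AddCommGroup H] [Module R H]

lemma exists_submodule_colon_eq_of_isPrime {X N : Submodule R H} (hX : X.FG) (hNX : N ≤ X)
    (c : Ideal R) (hc : ∀ r ∈ c, ∀ w ∈ X, r • w ∈ N) (q : Ideal R) [q.IsPrime]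
    (hcq : ¬ c ≤ q) (x : H) (hx : ∀ r ∉ q, r • x ∉ X) :
    ∃ (X' N' : Submodule R H) (n : ℕ), X'.FG ∧ N' ≤ X' ∧ X ≤ X' ∧ N' ⊓ X = N ∧
      (∀ r ∈ q * c ^ n, ∀ w ∈ X', r • w ∈ N') ∧ ∃ y ∈ X', ∀ r, r • y ∈ N' ↔ r ∈ q := by
  let X' := X ⊔ Submodule.span R {x}
  have hX' : X'.FG := hX.sup (Submodule.fg_span_singleton x)
  have hXX' : X ≤ X' := le_sup_left
  have hxX' : x ∈ X' := Submodule.mem_sup_right (Submodule.mem_span_singleton_self x)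
  have : Module.Finite R X' := .of_fg hX'
  let N₀ : Submodule R X' := N.comap X'.subtype
  obtain ⟨L, n, hLW, hL, y, hy⟩ := exists_colon_eq_of_isPrime
    ((X.comap X'.subtype).map N₀.mkQ) c
    (by
      rintro r hr _ ⟨w, hw, rfl⟩
      rw [← map_smul, Submodule.mkQ_apply, Submodule.Quotient.mk_eq_zero]
      exact hc r hr w hw) q hcq (N₀.mkQ ⟨x, hxX'⟩)
    (by
      intro r hr h
      rw [← map_smul, Submodule.mkQ_apply, Submodule.Quotient.mk_eq_zero] at h
      exact hx r hr (hNX h))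
  have hmem {w : H} (hw : w ∈ X') :
      w ∈ (L.comap N₀.mkQ).map X'.subtype ↔ N₀.mkQ ⟨w, hw⟩ ∈ L := by
    simp [hw]
  obtain ⟨y, rfl⟩ := Submodule.mkQ_surjective _ y
  refine ⟨X', (L.comap N₀.mkQ).map X'.subtype, n, hX', Submodule.map_subtype_le _ _, hXX', ?_,
    fun r hr w hw ↦ ?_, y, y.2, fun r ↦ ?_⟩
  · ext w
    constructor
    · rintro ⟨hw, hwX⟩
      rw [SetLike.mem_coe, hmem (hXX' hwX)] at hw
      have h₀ : N₀.mkQ ⟨w, hXX' hwX⟩ ∈ L ⊓ (X.comap X'.subtype).map N₀.mkQ :=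
        ⟨hw, ⟨⟨w, hXX' hwX⟩, hwX, rfl⟩⟩
      rw [hLW, Submodule.mem_bot, Submodule.mkQ_apply, Submodule.Quotient.mk_eq_zero] at h₀
      exact h₀
    · intro hw
      refine ⟨(hmem (hXX' (hNX hw))).2 ?_, hNX hw⟩
      rw [Submodule.mkQ_apply, (Submodule.Quotient.mk_eq_zero _).2 (show _ ∈ N₀ from hw)]
      exact zero_mem _
  · rw [hmem (X'.smul_mem r hw)]
    exact hL (Submodule.smul_mem_smul hr (Submodule.mem_top (x := N₀.mkQ ⟨w, hw⟩)))
  · rw [hmem (X'.smul_mem r y.2), ← hy, ← map_smul]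
    rfl

lemma IsWeaklyLaskerian.exists_fg_forall_exists_smul_mem [IsLocalRing R]
    (h : IsWeaklyLaskerian R H) (p : Ideal R) [p.IsPrime] (hp : 2 ≤ ringKrullDim (R ⧸ p)) :
    ∃ X : Submodule R H, X.FG ∧ ∀ x, ∃ s ∉ p, s • x ∈ X := by
  by_contra! hH
  obtain ⟨q, hq, hpq, hanti⟩ := exists_antichain_primes p hp
  let P (k : ℕ) (s : Submodule R H × Submodule R H) : Prop := s.1.FG ∧ s.2 ≤ s.1 ∧
    ∃ c : Ideal R, (∀ j, k ≤ j → ¬ c ≤ q j) ∧ ∀ r ∈ c, ∀ w ∈ s.1, r • w ∈ s.2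
  have hstep (k : ℕ) (s : {s // P k s}) : ∃ t : {t // P (k + 1) t}, s.1.1 ≤ t.1.1 ∧
      t.1.2 ⊓ s.1.1 = s.1.2 ∧ ∃ y ∈ t.1.1, ∀ r, r • y ∈ t.1.2 ↔ r ∈ q k := by
    obtain ⟨⟨X, N⟩, hX, hNX, c, hcq, hc⟩ := s
    obtain ⟨x, hx⟩ := hH X hX
    obtain ⟨X', N', n, hX', hNX', hXX', hN, hc', hy⟩ :=
      exists_submodule_colon_eq_of_isPrime hX hNX c hc (q k) (hcq k le_rfl) x
        (fun r hr ↦ hx r fun hrp ↦ hr (hpq k hrp))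
    refine ⟨⟨(X', N'), hX', hNX', q k * c ^ n, fun j hj hle ↦ ?_, hc'⟩, hXX', hN, hy⟩
    obtain hle | hle := (Ideal.IsPrime.mul_le (hq j)).1 hle
    · have := hanti _ _ hle
      lia
    · exact hcq j (by lia) (Ideal.IsPrime.le_of_pow_le hle)
  choose f hf₁ hf₂ y hy hyq using hstep
  let s (k : ℕ) : {s // P k s} := Nat.rec ⟨(⊥, ⊥), Submodule.fg_bot, le_rfl, ⊤,
    fun j _ hj ↦ (hq j).ne_top (top_le_iff.1 hj), fun r _ w hw ↦ (⊥ : Submodule R H).smul_mem r hw⟩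
    f k
  let X (k : ℕ) := (s k).1.1
  let N (k : ℕ) := (s k).1.2
  have hX : Monotone X := monotone_nat_of_le_succ fun k ↦ hf₁ k (s k)
  have hN (k : ℕ) : N (k + 1) ⊓ X k = N k := hf₂ k (s k)
  have hNmono : Monotone N := monotone_nat_of_le_succ fun k ↦ (hN k).symm.le.trans inf_le_left
  have hNX (k j : ℕ) : N (k + j) ⊓ X k ≤ N k := by
    induction j with
    | zero => exact inf_le_left
    | succ j ih =>
      refine le_trans (le_inf ?_ inf_le_right) ih
      exact (inf_le_inf_left _ (hX (Nat.le_add_right k j))).trans (hN (k + j)).le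
  have hass (k : ℕ) : q k ∈ associatedPrimes R (H ⧸ ⨆ k, N k) := by
    rw [AssociatedPrimes.mem_iff, isAssociatedPrime_iff]
    refine ⟨hq k, (⨆ k, N k).mkQ (y k (s k)), ?_⟩
    ext r
    have hiff : r • y k (s k) ∈ ⨆ k, N k ↔ r ∈ q k := by
      rw [← hyq k (s k), Submodule.mem_iSup_of_directed _ hNmono.directed_le]
      refine ⟨fun ⟨i, hi⟩ ↦ hNX (k + 1) i
        ⟨hNmono (by lia) hi, (X (k + 1)).smul_mem r (hy k (s k))⟩, fun h ↦ ⟨k + 1, h⟩⟩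
    rw [← hiff, Submodule.mem_colon_singleton, Submodule.mem_bot, ← map_smul, Submodule.mkQ_apply,
      Submodule.Quotient.mk_eq_zero]
  exact Set.infinite_of_injective_forall_mem (fun i j hij ↦ hanti i j hij.le) hass
    (h (⨆ k, N k))

end LocallyFinite

section Localization

variable {R : Type*} [CommRing R] (S : Submonoid R) {H : Type*} [AddCommGroup H] [Module R H]

lemma Module.finite_localizedModule_of_fg {X : Submodule R H} (hX : X.FG)
    (h : ∀ x, ∃ s ∈ S, s • x ∈ X) : Module.Finite (Localization S) (LocalizedModule S H) := by
  have : Module.Finite R X := .of_fg hX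
  refine Module.Finite.of_surjective (LocalizedModule.map S X.subtype) fun y ↦ ?_
  induction y using LocalizedModule.induction_on with
  | _ x s =>
    obtain ⟨t, ht, htx⟩ := h x
    refine ⟨LocalizedModule.mk ⟨t • x, htx⟩ (⟨t, ht⟩ * s), ?_⟩
    rw [LocalizedModule.map_mk]
    exact LocalizedModule.mk_cancel_common_left ⟨t, ht⟩ s x

lemma exists_fg_of_finite_localizedModule [Module.Finite (Localization S) (LocalizedModule S H)] :
    ∃ X : Submodule R H, X.FG ∧ ∀ x, ∃ s ∈ S, s • x ∈ X := by
  obtain ⟨G, hG⟩ := Module.Finite.fg_top (R := Localization S) (M := LocalizedModule S H)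
  choose num hnum using fun y ↦
    IsLocalizedModule.mk'_surjective S (LocalizedModule.mkLinearMap S H) y
  let X : Submodule R H := Submodule.span R ((fun y ↦ (num y).1) '' G)
  have hX : X.localized S = ⊤ := by
    rw [eq_top_iff, ← hG, Submodule.span_le]
    intro y hy
    exact (Submodule.mem_localized' ..).2 ⟨_, Submodule.subset_span ⟨y, hy, rfl⟩, _, hnum y⟩
  refine ⟨X, Submodule.fg_span (G.finite_toSet.image _), fun x ↦ ?_⟩
  obtain ⟨m, hm, s, hms⟩ := (Submodule.mem_localized' ..).1
    (hX ▸ Submodule.mem_top : LocalizedModule.mkLinearMap S H x ∈ X.localized S)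
  rw [IsLocalizedModule.mk'_eq_iff, Submonoid.smul_def, ← map_smul,
    IsLocalizedModule.eq_iff_exists S] at hms
  obtain ⟨t, ht⟩ := hms
  refine ⟨t * s, (t * s).2, ?_⟩
  rw [mul_smul]
  have : (t : R) • (s : R) • x = t • m := ht.symm
  rw [this]
  exact X.smul_mem _ hm

end Localization

section FiniteSupport

variable {R : Type*} [CommRing R] {H : Type*} [AddCommGroup H] [Module R H]

lemma IsAssociatedPrime.exists_smul_eq_zero_iff [IsNoetherianRing R] {q : Ideal R}
    (hq : IsAssociatedPrime q H) : ∃ x : H, ∀ r, r • x = 0 ↔ r ∈ q := by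
  obtain ⟨-, x, rfl⟩ := isAssociatedPrime_iff.1 hq
  exact ⟨x, fun r ↦ by simp⟩

lemma IsWeaklyLaskerian.of_finite_support [IsNoetherianRing R]
    (h : (Module.support R H).Finite) : IsWeaklyLaskerian R H := fun N ↦ by
  refine (h.image PrimeSpectrum.asIdeal).subset fun q hq ↦ ?_
  obtain ⟨x, hx⟩ := IsAssociatedPrime.exists_smul_eq_zero_iff hq
  exact ⟨⟨q, hq.isPrime⟩, Module.support_subset_of_surjective _ N.mkQ_surjective
    (Module.mem_support_iff'.2 ⟨x, fun r hr h ↦ hr ((hx r).1 h)⟩), rfl⟩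

lemma exists_mem_associatedPrimes_le_of_mem_support [IsNoetherianRing R] {p : PrimeSpectrum R}
    (hp : p ∈ Module.support R H) : ∃ q ∈ associatedPrimes R H, q ≤ p.asIdeal := by
  obtain ⟨x, hx⟩ := Module.mem_support_iff'.1 hp
  have hle : Module.annihilator R (Submodule.span R {x}) ≤ p.asIdeal := fun r hr ↦ by
    by_contra h
    exact hx r h congr(($(Module.mem_annihilator.1 hr
      ⟨x, Submodule.mem_span_singleton_self x⟩)).1)
  obtain ⟨q, hq, hqp⟩ := Ideal.exists_minimalPrimes_le hle
  exact ⟨q, associatedPrimes.subset_of_injective (Submodule.subtype_injective _)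
    (Module.associatedPrimes.minimalPrimes_annihilator_subset_associatedPrimes R _ hq), hqp⟩

lemma eq_or_eq_maximalIdeal_of_ringKrullDim_quotient_lt_two [IsLocalRing R] {q p : Ideal R}
    [q.IsPrime] [p.IsPrime] (hqp : q ≤ p) (hq : ringKrullDim (R ⧸ q) < 2) :
    p = q ∨ p = IsLocalRing.maximalIdeal R := by
  by_contra! h
  have hpm : p < IsLocalRing.maximalIdeal R :=
    lt_of_le_of_ne (IsLocalRing.le_maximalIdeal Ideal.IsPrime.ne_top') h.2
  have hqp : q < p := lt_of_le_of_ne hqp h.1.symm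
  rw [ringKrullDim_quotient] at hq
  refine absurd hq (not_lt.2 ?_)
  let s : LTSeries (PrimeSpectrum.zeroLocus (q : Set R)) :=
    { length := 2
      toFun := ![⟨⟨q, ‹_›⟩, le_refl q⟩, ⟨⟨p, ‹_›⟩, hqp.le⟩,
        ⟨⟨IsLocalRing.maximalIdeal R, inferInstance⟩, (hqp.trans hpm).le⟩]
      step := fun i ↦ by
        fin_cases i
        · exact hqp
        · exact hpm }
  exact Order.LTSeries.length_le_krullDim s

end FiniteSupport

section

variable {R : Type u} [CommRing R] [IsNoetherianRing R]

lemma le_of_mem_associatedPrimes_of_powTorsion (a : Ideal R) {H : Type u}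
    [AddCommGroup H] [Module R H] (hH : ∀ x, x ∈ powTorsion a H) {q : Ideal R}
    (hq : q ∈ associatedPrimes R H) : a ≤ q := by
  have := hq.isPrime
  obtain ⟨x, hx⟩ := IsAssociatedPrime.exists_smul_eq_zero_iff hq
  obtain ⟨n, hn⟩ := (mem_powTorsion a).1 (hH x)
  exact Ideal.IsPrime.le_of_pow_le (n := n) fun r hr ↦ (hx r).1 (hn r hr)

/-- An `a`-torsion module whose `a`-socle is weakly Laskerian is weakly Laskerian as soon as it
is locally finitely generated at its associated primes of dimension at least two. -/
lemma IsWeaklyLaskerian.of_torsionBySet [IsLocalRing R] (a : Ideal R) {H : Type u}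
    [AddCommGroup H] [Module R H] (hH : ∀ x, x ∈ powTorsion a H)
    (ha : IsWeaklyLaskerian R (Submodule.torsionBySet R H a))
    (hfin : ∀ (p : Ideal R) [p.IsPrime], p ∈ associatedPrimes R H → 2 ≤ ringKrullDim (R ⧸ p) →
      Module.Finite (Localization p.primeCompl) (LocalizedModule p.primeCompl H)) :
    IsWeaklyLaskerian R H := by
  have hAss : (associatedPrimes R H).Finite := by
    refine (ha ⊥).subset fun q hq ↦ ?_
    rw [LinearEquiv.AssociatedPrimes.eq (Submodule.quotEquivOfEqBot ⊥ rfl)]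
    obtain ⟨x, hx⟩ := IsAssociatedPrime.exists_smul_eq_zero_iff hq
    refine isAssociatedPrime_iff.2 ⟨hq.isPrime, ⟨x, ?_⟩, ?_⟩
    · exact (Submodule.mem_torsionBySet_iff ..).2 fun r ↦
        (hx r).2 (le_of_mem_associatedPrimes_of_powTorsion a hH hq r.2)
    · ext r
      simp [← hx r, Subtype.ext_iff]
  have hpow : ∀ p ∈ associatedPrimes R H, ∃ n, 2 ≤ ringKrullDim (R ⧸ p) →
      ∀ r ∈ a ^ n, ∀ x : H, ∃ s ∉ p, s • r • x = 0 := fun p hp ↦ by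
    have := hp.isPrime
    by_cases hdim : 2 ≤ ringKrullDim (R ⧸ p)
    · have := hfin p hp hdim
      obtain ⟨X, hX, h⟩ := exists_fg_of_finite_localizedModule p.primeCompl (H := H)
      obtain ⟨n, hn⟩ := exists_pow_smul_eq_zero_of_fg a hX fun x _ ↦ hH x
      refine ⟨n, fun _ r hr x ↦ ?_⟩
      obtain ⟨s, hs, hsx⟩ := h x
      exact ⟨s, hs, by rw [smul_comm]; exact hn r hr _ hsx⟩
    · exact ⟨0, fun h ↦ absurd h hdim⟩
  choose! n hn using hpow
  let N := hAss.toFinset.sup n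
  let Z : Submodule R H := (a ^ N) • ⊤
  refine .of_forall_smul_mem (a ^ N) (Z := Z)
    (fun r hr x ↦ Submodule.smul_mem_smul hr Submodule.mem_top) (ha.torsionBySet_pow a N) ?_
  have hkill : ∀ p ∈ associatedPrimes R H, 2 ≤ ringKrullDim (R ⧸ p) → ∀ z ∈ Z,
      ∃ s ∉ p, s • z = 0 := fun p hp hdim z hz ↦ by
    have := hp.isPrime
    refine Submodule.smul_induction_on hz (fun r hr x _ ↦ hn p hp hdim r (Ideal.pow_le_pow_right
      (Finset.le_sup (f := n) (hAss.mem_toFinset.2 hp)) hr) x) ?_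
    rintro x y ⟨s, hs, hsx⟩ ⟨t, ht, hty⟩
    refine ⟨s * t, p.primeCompl.mul_mem hs ht, ?_⟩
    rw [smul_add, mul_comm, mul_smul, hsx, mul_comm, mul_smul, hty, smul_zero, smul_zero,
      add_zero]
  refine .of_finite_support (Set.Finite.subset (((hAss.insert (IsLocalRing.maximalIdeal R)).preimage
    (Function.Injective.injOn fun _ _ ↦ PrimeSpectrum.ext))) fun p hp ↦ ?_)
  obtain ⟨q, hq, hqp⟩ := exists_mem_associatedPrimes_le_of_mem_support hp
  have hqH : q ∈ associatedPrimes R H :=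
    associatedPrimes.subset_of_injective Z.subtype_injective hq
  have := hq.isPrime
  have hdim : ringKrullDim (R ⧸ q) < 2 := by
    by_contra! hdim
    obtain ⟨z, hz⟩ := IsAssociatedPrime.exists_smul_eq_zero_iff hq
    obtain ⟨s, hs, hsz⟩ := hkill q hqH hdim z z.2
    exact hs ((hz s).1 (Subtype.ext hsz))
  rcases eq_or_eq_maximalIdeal_of_ringKrullDim_quotient_lt_two hqp hdim with h | h
  · exact .inr (by simpa only [h] using hqH)
  · exact .inl h

end

section

variable {R M : Type u} [CommRing R] [IsNoetherianRing R] [AddCommGroup M] [Module R M]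
  (a : Ideal R)

lemma LocCoh.finite_localizedModule_iff (p : Ideal R) [p.IsPrime] (i : ℕ) :
    Module.Finite (Localization p.primeCompl) (LocalizedModule p.primeCompl (LocCoh a i M)) ↔
      Module.Finite (Localization.AtPrime p) (LocCoh
        (a.map (algebraMap R (Localization.AtPrime p))) i (LocalizedModule p.primeCompl M)) :=
  Module.Finite.equiv_iff (LocCoh.nonempty_localization_linearEquiv p.primeCompl a i).some

variable [IsLocalRing R]

lemma LocCoh.isWeaklyLaskerian_of_lt_fDimN [Module.Finite R M] {j : ℕ}
    (hj : (j : ℕ∞) < fDimN R a M 2) :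
    IsWeaklyLaskerian R (LocCoh a j M) := by
  induction j using Nat.strong_induction_on with
  | _ j ih =>
    refine .of_torsionBySet a (LocCoh.mem_powTorsion a j) (torsionBySet_locCoh_isWeaklyLaskerian a j
      M (fun i _ ↦ .ext _ .of_finite i) fun i hi ↦ ih i hi (lt_trans (by exact_mod_cast hi) hj)) ?_
    intro p _ hp hdim
    rw [LocCoh.finite_localizedModule_iff]
    by_cases hpM : ⟨p, ‹_›⟩ ∈ Module.support R M
    · have hap : a ≤ p := le_of_mem_associatedPrimes_of_powTorsion a (LocCoh.mem_powTorsion a j) hp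
      by_contra hfin
      refine absurd hj (not_lt.2 (le_trans (sInf_le ⟨⟨p, ‹_›⟩, ?_, ?_, rfl⟩)
        (sInf_le ⟨j, rfl, hfin⟩)))
      · rw [Module.support_quotient]
        exact ⟨hpM, hap⟩
      · exact_mod_cast hdim
    · have : Subsingleton (LocalizedModule p.primeCompl M) := Module.notMem_support_iff.1 hpM
      exact .of_finite

lemma LocCoh.not_isWeaklyLaskerian_of_not_finite {j : ℕ} (p : Ideal R) [p.IsPrime]
    (hp : 2 ≤ ringKrullDim (R ⧸ p))
    (h : ¬ Module.Finite (Localization.AtPrime p) (LocCoh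
      (a.map (algebraMap R (Localization.AtPrime p))) j (LocalizedModule p.primeCompl M))) :
    ¬ IsWeaklyLaskerian R (LocCoh a j M) := fun hW ↦ by
  obtain ⟨X, hX, hs⟩ := hW.exists_fg_forall_exists_smul_mem p hp
  exact h ((LocCoh.finite_localizedModule_iff a p j).1
    (Module.finite_localizedModule_of_fg p.primeCompl hX hs))

end

theorem fDimN_two_eq_inf_not_weaklyLaskerian (R M : Type u) [CommRing R] [IsNoetherianRing R]
    [IsLocalRing R] [IsAdicComplete (IsLocalRing.maximalIdeal R) R]
    [AddCommGroup M] [Module R M] [Module.Finite R M] (a : Ideal R) :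
    fDimN R a M 2 = sInf {i : ℕ∞ | ∃ j : ℕ, i = j ∧
      ¬ ∀ N : Submodule R ((localCohomology a j).obj (ModuleCat.of R M)),
          (associatedPrimes R (((localCohomology a j).obj (ModuleCat.of R M)) ⧸ N)).Finite} := by
  apply le_antisymm
  · refine le_sInf ?_
    rintro _ ⟨j, rfl, hj⟩
    by_contra! hlt
    exact hj (LocCoh.isWeaklyLaskerian_of_lt_fDimN a hlt)
  · refine le_sInf ?_
    rintro _ ⟨p, -, hp, rfl⟩
    refine le_sInf ?_
    rintro _ ⟨j, rfl, hj⟩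
    exact sInf_le ⟨j, rfl,
      LocCoh.not_isWeaklyLaskerian_of_not_finite a p.asIdeal (by exact_mod_cast hp) hj⟩
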